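/- arXiv:2503.15748 — 15 statements merged into one kernel-verified Lean document; each statement's English description precedes it below -/
import Mathlib

section
/- Closed form of the proximal map of PAR, flat segments: for every u ∈ ℝ and every k ∈ {0, 1, …, m} such that a_{k-1} + q_k ≤ |u| ≤ a_k + q_k, the function w ↦ Ψ(w) + (1/2)(w − u)² has a unique minimizer over ℝ, and this minimizer equals sgn(u)·q_k. -/
theorem par_mono_aux (m : ℕ) (f : ℕ → ℝ) (hf : ∀ k, k < m → f k < f (k + 1)) (i : ℕ) :
    ∀ j, i ≤ j → j ≤ m → f i ≤ f j := by
  intro j hij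
  induction j, hij using Nat.le_induction with
  | base => intro _; exact le_refl _
  | succ j _ ih =>
    intro hj
    have h1 := ih (by omega)
    have h2 := hf j (by omega)
    linarith

/-- Closed form of the proximal map of PAR, flat segments:
for every `u` and every `k ∈ {0, …, m}` such that `a_{k-1} + q_k ≤ |u| ≤ a_k + q_k`
(with the convention `a_{-1} = 0`), the function `w ↦ Ψ(w) + (1/2)(w − u)²`
has a unique minimizer over ℝ, and this minimizer equals `sgn(u)·q_k`. -/
theorem par_prox_flat
    (m : ℕ) (hm : 1 ≤ m)
    (q a b : ℕ → ℝ)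
    (hq0 : q 0 = 0)
    (hq : ∀ k, k < m → q k < q (k + 1))
    (ha0 : 0 ≤ a 0)
    (ha : ∀ k, k < m → a k < a (k + 1))
    (hb0 : b 0 = 0)
    (hb : ∀ k, 1 ≤ k → k ≤ m → b k = b (k - 1) + a (k - 1) * (q k - q (k - 1)))
    (Ψ : ℝ → ℝ)
    (hΨ : ∀ w, Ψ w = (Finset.range (m + 1)).sup'
      (Finset.nonempty_range_iff.mpr (Nat.succ_ne_zero m))
      (fun k => a k * (|w| - q k) + b k))
    (u : ℝ) (k : ℕ) (hk : k ≤ m)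
    (hlo : (if k = 0 then (0 : ℝ) else a (k - 1)) + q k ≤ |u|)
    (hhi : |u| ≤ a k + q k) :
    ∀ v : ℝ, v ≠ Real.sign u * q k →
      Ψ (Real.sign u * q k) + (1 / 2) * (Real.sign u * q k - u) ^ 2
        < Ψ v + (1 / 2) * (v - u) ^ 2 := by
  have hqm := par_mono_aux m q hq
  have ham := par_mono_aux m a ha
  have hb' : ∀ j, j < m → b (j + 1) = b j + a j * (q (j + 1) - q j) := by
    intro j hj
    have := hb (j + 1) (by omega) (by omega)
    simpa using this
  have up : ∀ j i, j ≤ i → i ≤ m → a j * (q i - q j) + b j ≤ b i := by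
    intro j i hij
    induction i, hij using Nat.le_induction with
    | base => intro _; simp
    | succ i hji ih =>
      intro hi
      have h1 := ih (by omega)
      have h2 := hb' i (by omega)
      have h3 := ham j i hji (by omega)
      have h4 := hq i (by omega)
      nlinarith [mul_nonneg (sub_nonneg.2 h3) (sub_nonneg.2 h4.le)]
  have down : ∀ i j, i ≤ j → j ≤ m → a j * (q i - q j) + b j ≤ b i := by
    intro i j hij
    induction j, hij using Nat.le_induction with
    | base => intro _; simp
    | succ j hji ih =>
      intro hj
      have h1 := ih (by omega)
      have h2 := hb' j (by omega)
      have h3 := ha j (by omega)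
      have h4 := hqm i (j + 1) (by omega) hj
      nlinarith [mul_nonneg (sub_nonneg.2 h3.le) (sub_nonneg.2 h4)]
  have hQ : 0 ≤ q k := hq0 ▸ hqm 0 k (Nat.zero_le _) hk
  have hge : ∀ w j, j ≤ m → a j * (|w| - q j) + b j ≤ Ψ w := by
    intro w j hj
    rw [hΨ]
    exact Finset.le_sup' (fun k => a k * (|w| - q k) + b k) (Finset.mem_range.2 (by omega))
  have hle : ∀ w, |w| = q k → Ψ w ≤ b k := by
    intro w hw
    rw [hΨ]
    apply Finset.sup'_le
    intro j hj
    have hj' := Finset.mem_range.1 hj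
    rw [hw]
    rcases le_total j k with h | h
    · exact up j k h hk
    · exact down k j h (by omega)
  have key : ∀ v, (|u| - q k) * (|v| - q k) + b k ≤ Ψ v := by
    intro v
    rcases le_total (q k) (|v|) with h | h
    · have h1 := hge v k hk
      nlinarith [mul_nonneg (sub_nonneg.2 h) (sub_nonneg.2 hhi)]
    · rcases k with _ | k
      · have h0 : |v| = q 0 := le_antisymm h (by rw [hq0]; exact abs_nonneg v)
        have h1 := hge v 0 hk
        rw [h0] at h1 ⊢
        simpa using h1
      · have h1 := hge v k (by omega)
        have h2 := hb' k (by omega)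
        simp at hlo
        nlinarith [mul_nonneg (sub_nonneg.2 h) (sub_nonneg.2 hlo)]
  have hu0 : u = 0 → q k = 0 := by
    intro h
    rcases k with _ | k
    · exact hq0
    · have h1 := ham 0 k (by omega) (by omega)
      simp [h] at hlo
      linarith
  intro v hv
  have hkv := key v
  have hsq := sq_abs v
  rcases lt_trichotomy u 0 with h | h | h
  · rw [Real.sign_of_neg h] at hv ⊢
    have h1 := hle (-1 * q k) (by rw [neg_one_mul, abs_neg, abs_of_nonneg hQ])
    rw [abs_of_neg h] at hkv
    have h2 : 0 ≤ |v| + v := by linarith [neg_abs_le v]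
    have h3 : 0 < (|v| - q k) ^ 2 / 2 + (-u) * (|v| + v) := by
      rcases h2.eq_or_lt with h4 | h4
      · have : |v| - q k ≠ 0 := fun h5 => hv (by linarith)
        rw [← h4, mul_zero, add_zero]; positivity
      · have := mul_pos (neg_pos.2 h) h4
        positivity
    nlinarith
  · have hq' := hu0 h
    subst h
    rw [hq'] at hv ⊢
    have h1 := hle (Real.sign 0 * 0) (by simp [hq'])
    have hv' : v ≠ 0 := by simpa using hv
    have : 0 < v ^ 2 := by positivity
    simp [hq'] at hkv h1 ⊢
    linarith
  · rw [Real.sign_of_pos h] at hv ⊢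
    have h1 := hle (1 * q k) (by rw [one_mul, abs_of_nonneg hQ])
    rw [abs_of_pos h] at hkv
    have h2 : 0 ≤ |v| - v := by linarith [le_abs_self v]
    have h3 : 0 < (|v| - q k) ^ 2 / 2 + u * (|v| - v) := by
      rcases h2.eq_or_lt with h4 | h4
      · have : |v| - q k ≠ 0 := fun h5 => hv (by linarith)
        rw [← h4, mul_zero, add_zero]; positivity
      · have := mul_pos h h4
        positivity
    nlinarith
end

section
/- Closed form of the proximal map of PAR, slanted segments: for every u ∈ ℝ, if either k ∈ {0, 1, …, m−1} and a_k + q_k ≤ |u| ≤ a_k + q_{k+1}, or k = m and |u| ≥ a_m + q_m, then the function w ↦ Ψ(w) + (1/2)(w − u)² has a unique minimizer over ℝ, and this minimizer equals u − sgn(u)·a_k. -/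
/-- Closed form of the proximal map of PAR, slanted segments:
for every `u`, if either `k ∈ {0, …, m−1}` and `a_k + q_k ≤ |u| ≤ a_k + q_{k+1}`,
or `k = m` and `|u| ≥ a_m + q_m`, then the function `w ↦ Ψ(w) + (1/2)(w − u)²`
has a unique minimizer over ℝ, and this minimizer equals `u − sgn(u)·a_k`. -/
theorem par_prox_slanted
    (m : ℕ) (hm : 1 ≤ m)
    (q a b : ℕ → ℝ)
    (hq0 : q 0 = 0)
    (hq : ∀ k, k < m → q k < q (k + 1))
    (ha0 : 0 ≤ a 0)
    (ha : ∀ k, k < m → a k < a (k + 1))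
    (hb0 : b 0 = 0)
    (hb : ∀ k, 1 ≤ k → k ≤ m → b k = b (k - 1) + a (k - 1) * (q k - q (k - 1)))
    (Ψ : ℝ → ℝ)
    (hΨ : ∀ w, Ψ w = (Finset.range (m + 1)).sup'
      (Finset.nonempty_range_iff.mpr (Nat.succ_ne_zero m))
      (fun k => a k * (|w| - q k) + b k))
    (u : ℝ) (k : ℕ)
    (hcase : (k < m ∧ a k + q k ≤ |u| ∧ |u| ≤ a k + q (k + 1)) ∨
             (k = m ∧ a m + q m ≤ |u|)) :
    ∀ v : ℝ, v ≠ u - Real.sign u * a k →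
      Ψ (u - Real.sign u * a k) + (1 / 2) * ((u - Real.sign u * a k) - u) ^ 2
        < Ψ v + (1 / 2) * (v - u) ^ 2 := by
  have hkm : k ≤ m := by rcases hcase with h | h <;> omega
  have hs : a k + q k ≤ |u| := by
    rcases hcase with h | ⟨rfl, h⟩
    · exact h.2.1
    · exact h
  have qmono : ∀ i d, i + d ≤ m → q i ≤ q (i + d) := by
    intro i d
    induction d with
    | zero => intro _; simp
    | succ d ih =>
      intro h
      have h1 := ih (by omega)
      have h2 := hq (i + d) (by omega)
      rw [← add_assoc]; linarith
  have anonneg : ∀ i, i ≤ m → 0 ≤ a i := by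
    intro i
    induction i with
    | zero => intro _; exact ha0
    | succ d ih =>
      intro h
      have h1 := ih (by omega)
      have h2 := ha d (by omega)
      linarith
  have hak := anonneg k hkm
  have hqk : 0 ≤ q k := by
    have := qmono 0 k (by omega)
    rw [hq0] at this; simpa using this
  have step : ∀ i x, i < m → (a (i+1) * (x - q (i+1)) + b (i+1)) - (a i * (x - q i) + b i)
      = (a (i+1) - a i) * (x - q (i+1)) := by
    intro i x hi
    have := hb (i+1) (by omega) (by omega)
    simp only [Nat.add_sub_cancel] at this
    rw [this]; ring
  have up : ∀ d i, i + d = k → ∀ x, q k ≤ x →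
      a i * (x - q i) + b i ≤ a k * (x - q k) + b k := by
    intro d
    induction d with
    | zero => intro i h x _; simp at h; subst h; exact le_rfl
    | succ d ih =>
      intro i h x hx
      have h1 := ih (i+1) (by omega) x hx
      have h2 := step i x (by omega)
      have h3 := ha i (by omega)
      have h4 := qmono (i+1) d (by omega)
      rw [show i + 1 + d = k by omega] at h4
      have := mul_nonneg (sub_nonneg.2 h3.le) (sub_nonneg.2 (h4.trans hx))
      linarith
  have down : ∀ d, k + d ≤ m → ∀ x, (k < m → x ≤ q (k+1)) →
      a (k + d) * (x - q (k + d)) + b (k + d) ≤ a k * (x - q k) + b k := by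
    intro d
    induction d with
    | zero => intro h x _; simp
    | succ d ih =>
      intro h x hx
      have h1 := ih (by omega) x hx
      have h2 := step (k+d) x (by omega)
      have h3 := ha (k+d) (by omega)
      have h4 := qmono (k+1) d (by omega)
      rw [show k + 1 + d = k + d + 1 by omega] at h4
      have := mul_nonneg (sub_nonneg.2 h3.le) (sub_nonneg.2 ((hx (by omega)).trans h4))
      rw [← add_assoc]
      linarith
  have hw : |u - Real.sign u * a k| = |u| - a k := by
    rcases lt_trichotomy u 0 with h | h | h
    · rw [Real.sign_of_neg h]
      rw [abs_of_neg h] at hs ⊢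
      rw [abs_of_nonpos (by linarith)]; ring
    · subst h; simp at hs ⊢; linarith
    · rw [Real.sign_of_pos h]
      rw [abs_of_pos h] at hs ⊢
      rw [abs_of_nonneg (by linarith)]; ring
  have hle : Ψ (u - Real.sign u * a k) ≤ a k * (|u| - a k - q k) + b k := by
    rw [hΨ, hw]
    apply Finset.sup'_le
    intro j hj
    have hj' : j ≤ m := by simpa [Nat.lt_succ_iff] using hj
    rcases le_total j k with h | h
    · exact up (k - j) j (by omega) _ (by linarith)
    · obtain ⟨d, rfl⟩ := Nat.exists_eq_add_of_le h
      refine down d hj' _ ?_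
      intro hlt
      rcases hcase with h | h
      · linarith [h.2.2]
      · omega
  intro v hv
  have hge : a k * (|v| - q k) + b k ≤ Ψ v := by
    rw [hΨ]
    exact Finset.le_sup' (fun k => a k * (|v| - q k) + b k)
      (Finset.mem_range.2 (by omega))
  have hpos : 0 < (v - (u - Real.sign u * a k)) ^ 2 := by
    have := sub_ne_zero.2 hv
    positivity
  rcases lt_trichotomy u 0 with h | h | h
  · rw [Real.sign_of_neg h] at *
    rw [abs_of_neg h] at *
    have := mul_le_mul_of_nonneg_left (neg_abs_le v) hak
    nlinarith
  · subst h
    simp at hs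
    have h0 : a k = 0 := by linarith
    simp only [h0] at *
    simp at *
    nlinarith
  · rw [Real.sign_of_pos h] at *
    rw [abs_of_pos h] at *
    have := mul_le_mul_of_nonneg_left (le_abs_self v) hak
    nlinarith
end

section
/- First-order optimality condition for PAR-regularized minimization, zero case: let f : ℝ → ℝ be convex and differentiable, let λ > 0, and let w* be a minimizer over ℝ of w ↦ f(w) + λΨ(w). If |f'(w*)| < λ·a_0, then w* = 0. -/
/-- First-order optimality condition for PAR-regularized minimization,
zero case: let `f` be convex and differentiable, `λ > 0`, and `w*` a minimizer of
`w ↦ f(w) + λΨ(w)`. If `|f'(w*)| < λ·a_0`, then `w* = 0`. -/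
theorem par_optimality_zero
    (m : ℕ) (hm : 1 ≤ m)
    (q a b : ℕ → ℝ)
    (hq0 : q 0 = 0)
    (hq : ∀ k, k < m → q k < q (k + 1))
    (ha0 : 0 ≤ a 0)
    (ha : ∀ k, k < m → a k < a (k + 1))
    (hb0 : b 0 = 0)
    (hb : ∀ k, 1 ≤ k → k ≤ m → b k = b (k - 1) + a (k - 1) * (q k - q (k - 1)))
    (Ψ : ℝ → ℝ)
    (hΨ : ∀ w, Ψ w = (Finset.range (m + 1)).sup'
      (Finset.nonempty_range_iff.mpr (Nat.succ_ne_zero m))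
      (fun k => a k * (|w| - q k) + b k))
    (f : ℝ → ℝ) (hfconv : ConvexOn ℝ Set.univ f) (hfdiff : Differentiable ℝ f)
    (lam : ℝ) (hlam : 0 < lam)
    (wstar : ℝ)
    (hmin : ∀ w : ℝ, f wstar + lam * Ψ wstar ≤ f w + lam * Ψ w)
    (hgrad : |deriv f wstar| < lam * a 0) :
    wstar = 0 := by
  by_contra hne
  have hpos : 0 < |wstar| := abs_pos.mpr hne
  have hak : ∀ k, k ≤ m → a 0 ≤ a k := by
    intro k
    induction k with
    | zero => intro _; exact le_rfl
    | succ n ih =>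
      intro h
      exact (ih (by omega)).trans (ha n (by omega)).le
  have key : ∀ t : ℝ, 0 < t → t < 1 →
      Ψ (wstar - t * wstar) ≤ Ψ wstar - a 0 * (t * |wstar|) := by
    intro t ht0 ht1
    rw [hΨ (wstar - t * wstar)]
    apply Finset.sup'_le
    intro k hk
    have hk' : a k * (|wstar| - q k) + b k ≤ Ψ wstar := by
      rw [hΨ wstar]
      exact Finset.le_sup' (fun k => a k * (|wstar| - q k) + b k) hk
    have h1 : |wstar - t * wstar| = |wstar| - t * |wstar| := by
      rw [show wstar - t * wstar = (1 - t) * wstar by ring, abs_mul,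
        abs_of_pos (by linarith : (0 : ℝ) < 1 - t)]
      ring
    have h2 := mul_le_mul_of_nonneg_right
      (hak k (by have := Finset.mem_range.mp hk; omega)) (mul_pos ht0 hpos).le
    rw [h1]
    nlinarith
  have hd : HasDerivAt (fun t : ℝ => f (wstar - t * wstar)) (deriv f wstar * (-wstar)) 0 := by
    have hi : HasDerivAt (fun t : ℝ => wstar - t * wstar) (-wstar) 0 := by
      simpa using ((hasDerivAt_id (0 : ℝ)).mul_const wstar).const_sub wstar
    have ho : HasDerivAt f (deriv f wstar) (wstar - 0 * wstar) := by
      simpa using (hfdiff wstar).hasDerivAt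
    exact ho.comp (0 : ℝ) hi
  have hlim := hd.tendsto_slope_zero_right
  have hge : lam * a 0 * |wstar| ≤ deriv f wstar * (-wstar) := by
    refine ge_of_tendsto hlim ?_
    filter_upwards [Ioo_mem_nhdsGT (zero_lt_one : (0 : ℝ) < 1)] with t ht
    have h1 := key t ht.1 ht.2
    have h2 := hmin (wstar - t * wstar)
    have h3 := mul_le_mul_of_nonneg_left h1 hlam.le
    simp only [zero_add, zero_mul, sub_zero, smul_eq_mul]
    rw [inv_mul_eq_div, le_div_iff₀ ht.1]
    nlinarith
  have h4 : deriv f wstar * (-wstar) ≤ |deriv f wstar| * |wstar| := by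
    rw [← abs_neg wstar, ← abs_mul]
    exact le_abs_self _
  nlinarith
end

section
/- First-order optimality condition for PAR-regularized minimization, quantized case: let f : ℝ → ℝ be convex and differentiable, let λ > 0, let w* be a minimizer over ℝ of w ↦ f(w) + λΨ(w), and let k ∈ {1, …, m}. If −λ·a_k < f'(w*) < −λ·a_{k-1}, then w* = q_k; and if λ·a_{k-1} < f'(w*) < λ·a_k, then w* = −q_k. -/
/-- First-order optimality condition for PAR-regularized minimization,
quantized case: let `f` be convex and differentiable, `λ > 0`, `w*` a minimizer of
`w ↦ f(w) + λΨ(w)`, and `k ∈ {1, …, m}`. If `−λ·a_k < f'(w*) < −λ·a_{k-1}`, then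
`w* = q_k`; and if `λ·a_{k-1} < f'(w*) < λ·a_k`, then `w* = −q_k`. -/
theorem par_optimality_quantized
    (m : ℕ) (hm : 1 ≤ m)
    (q a b : ℕ → ℝ)
    (hq0 : q 0 = 0)
    (hq : ∀ k, k < m → q k < q (k + 1))
    (ha0 : 0 ≤ a 0)
    (ha : ∀ k, k < m → a k < a (k + 1))
    (hb0 : b 0 = 0)
    (hb : ∀ k, 1 ≤ k → k ≤ m → b k = b (k - 1) + a (k - 1) * (q k - q (k - 1)))
    (Ψ : ℝ → ℝ)
    (hΨ : ∀ w, Ψ w = (Finset.range (m + 1)).sup'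
      (Finset.nonempty_range_iff.mpr (Nat.succ_ne_zero m))
      (fun k => a k * (|w| - q k) + b k))
    (f : ℝ → ℝ) (hfconv : ConvexOn ℝ Set.univ f) (hfdiff : Differentiable ℝ f)
    (lam : ℝ) (hlam : 0 < lam)
    (wstar : ℝ)
    (hmin : ∀ w : ℝ, f wstar + lam * Ψ wstar ≤ f w + lam * Ψ w)
    (k : ℕ) (hk1 : 1 ≤ k) (hkm : k ≤ m) :
    (-(lam * a k) < deriv f wstar → deriv f wstar < -(lam * a (k - 1)) →
        wstar = q k) ∧
    (lam * a (k - 1) < deriv f wstar → deriv f wstar < lam * a k →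
        wstar = -q k) := by
  have key : ∀ j n, j + n ≤ m → a j ≤ a (j+n) ∧ q j ≤ q (j+n) ∧
      a j * (q (j+n) - q j) + b j ≤ b (j+n) ∧ b (j+n) - b j ≤ a (j+n) * (q (j+n) - q j) := by
    intro j n
    induction n with
    | zero => intro _; simp
    | succ n ih =>
      intro h
      obtain ⟨h1, h2, h3, h4⟩ := ih (by omega)
      have e1 := ha (j+n) (by omega)
      have e2 := hq (j+n) (by omega)
      have e3 := hb (j+n+1) (by omega) (by omega)
      simp only [Nat.add_sub_cancel] at e3
      rw [← add_assoc]
      refine ⟨by linarith, by linarith, ?_, ?_⟩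
      · nlinarith [mul_nonneg (sub_nonneg.2 h1) (sub_nonneg.2 e2.le)]
      · nlinarith [mul_nonneg (sub_nonneg.2 e1.le) (sub_nonneg.2 h2),
          mul_nonneg (sub_nonneg.2 e1.le) (sub_nonneg.2 e2.le)]
  have hanon : ∀ j, j ≤ m → 0 ≤ a j := by
    intro j hj
    have := (key 0 j (by omega)).1
    rw [zero_add] at this
    linarith
  have hqk : 0 ≤ q k := by
    have := (key 0 k (by omega)).2.1
    rw [zero_add, hq0] at this
    exact this
  have hge : ∀ w j, j ≤ m → a j * (|w| - q j) + b j ≤ Ψ w := by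
    intro w j hj
    rw [hΨ]
    exact Finset.le_sup' (fun k => a k * (|w| - q k) + b k) (Finset.mem_range.2 (by omega))
  have hle : ∀ w c, (∀ j, j ≤ m → a j * (|w| - q j) + b j ≤ c) → Ψ w ≤ c := by
    intro w c h
    rw [hΨ]
    refine Finset.sup'_le _ _ fun j hj => h j ?_
    have := Finset.mem_range.1 hj
    omega
  have hΨq : ∀ w, |w| = q k → Ψ w ≤ b k := by
    intro w hw
    refine hle _ _ fun j hj => ?_
    rw [hw]
    rcases le_total j k with h | h
    · obtain ⟨n, rfl⟩ := Nat.exists_eq_add_of_le h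
      exact (key j n hkm).2.2.1
    · obtain ⟨n, rfl⟩ := Nat.exists_eq_add_of_le h
      have := (key k n hj).2.2.2
      linarith
  have hsub : ∀ v, 0 ≤ deriv f wstar * (v - wstar) + lam * (Ψ v - Ψ wstar) := by
    intro v
    have hd : HasDerivAt (fun t : ℝ => f (wstar + t * (v - wstar)) + t * (lam * (Ψ v - Ψ wstar)))
        (deriv f wstar * (v - wstar) + lam * (Ψ v - Ψ wstar)) 0 := by
      have h1 : HasDerivAt (fun t : ℝ => wstar + t * (v - wstar)) (v - wstar) 0 := by
        simpa using ((hasDerivAt_id (0:ℝ)).mul_const (v - wstar)).const_add wstar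
      have h2 : HasDerivAt f (deriv f wstar) (wstar + 0 * (v - wstar)) := by
        simpa using (hfdiff wstar).hasDerivAt
      have h3 := h2.comp (0:ℝ) h1
      have h4 : HasDerivAt (fun t : ℝ => t * (lam * (Ψ v - Ψ wstar))) (lam * (Ψ v - Ψ wstar)) 0 := by
        simpa using (hasDerivAt_id (0:ℝ)).mul_const (lam * (Ψ v - Ψ wstar))
      exact h3.add h4
    have ht := (hasDerivWithinAt_iff_tendsto_slope' (by simp)).1
      (hd.hasDerivWithinAt (s := Set.Ioi 0))
    refine ge_of_tendsto ht ?_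
    filter_upwards [Ioo_mem_nhdsGT (show (0:ℝ) < 1 by norm_num)] with t ht
    obtain ⟨t0, t1⟩ := ht
    have hc : Ψ (wstar + t * (v - wstar)) ≤ (1 - t) * Ψ wstar + t * Ψ v := by
      refine hle _ _ fun j hj => ?_
      have e1 := hge wstar j hj
      have e2 := hge v j hj
      have e3 : |wstar + t * (v - wstar)| ≤ (1 - t) * |wstar| + t * |v| := by
        have : wstar + t * (v - wstar) = (1 - t) * wstar + t * v := by ring
        rw [this]
        refine (abs_add_le _ _).trans ?_
        rw [abs_mul, abs_mul, abs_of_pos t0, abs_of_pos (sub_pos.2 t1)]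
      have e4 := mul_le_mul_of_nonneg_left e3 (hanon j hj)
      have e5 := mul_le_mul_of_nonneg_left e1 (sub_pos.2 t1).le
      have e6 := mul_le_mul_of_nonneg_left e2 t0.le
      nlinarith
    have hm' := hmin (wstar + t * (v - wstar))
    have hc' := mul_le_mul_of_nonneg_left hc hlam.le
    rw [slope_def_field]
    apply div_nonneg
    · simp only [zero_mul, add_zero]
      nlinarith
    · linarith
  have hk := hge wstar k hkm
  have hk' := hge wstar (k-1) (by omega)
  have hbk := hb k hk1 hkm
  have hak' := hanon (k-1) (by omega)
  have hak := hanon k hkm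
  have l1 : lam * (a k * (|wstar| - q k)) ≤ lam * (Ψ wstar - b k) :=
    mul_le_mul_of_nonneg_left (by linarith) hlam.le
  have l2 : lam * (a (k-1) * (|wstar| - q k)) ≤ lam * (Ψ wstar - b k) :=
    mul_le_mul_of_nonneg_left (by linarith) hlam.le
  have p1 := mul_nonneg hlam.le hak
  have p2 := mul_nonneg hlam.le hak'
  have n1 := le_abs_self wstar
  have n2 := neg_le_abs wstar
  constructor
  · intro h1 h2
    have s1 := hsub (q k)
    have s2 := mul_le_mul_of_nonneg_left (hΨq (q k) (abs_of_nonneg hqk)) hlam.le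
    rcases lt_trichotomy wstar (q k) with h | h | h
    · nlinarith [mul_pos (sub_pos.2 h) (sub_pos.2 h2), mul_nonneg p2 (sub_nonneg.2 n1)]
    · exact h
    · nlinarith [mul_pos (sub_pos.2 h) (sub_pos.2 h1), mul_nonneg p1 (sub_nonneg.2 n1)]
  · intro h1 h2
    have s1 := hsub (-q k)
    have s2 := mul_le_mul_of_nonneg_left (hΨq (-q k) (by rw [abs_neg, abs_of_nonneg hqk])) hlam.le
    rcases lt_trichotomy wstar (-q k) with h | h | h
    · nlinarith [mul_pos (sub_pos.2 h) (sub_pos.2 h2), mul_nonneg p1 (sub_nonneg.2 n2)]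
    · exact h
    · nlinarith [mul_pos (sub_pos.2 h) (sub_pos.2 h1), mul_nonneg p2 (sub_nonneg.2 n2)]
end

section
/- First-order necessary condition for non-quantized minimizers: let f : ℝ → ℝ be convex and differentiable, let λ > 0, let w* be a minimizer over ℝ of w ↦ f(w) + λΨ(w), and let k ∈ {1, …, m}. If q_{k-1} < w* < q_k, then f'(w*) = −λ·a_{k-1}; and if −q_k < w* < −q_{k-1}, then f'(w*) = λ·a_{k-1}. -/
lemma par_q_mono (m : ℕ) (q : ℕ → ℝ) (hq : ∀ k, k < m → q k < q (k + 1))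
    (i n : ℕ) (h : i + n ≤ m) : q i ≤ q (i + n) := by
  induction n with
  | zero => simp
  | succ n ih =>
    have := hq (i + n) (by omega)
    have := ih (by omega)
    rw [← add_assoc]; linarith

lemma par_piece (m : ℕ) (q a b : ℕ → ℝ)
    (hq : ∀ k, k < m → q k < q (k + 1))
    (ha : ∀ k, k < m → a k < a (k + 1))
    (hb : ∀ k, 1 ≤ k → k ≤ m → b k = b (k - 1) + a (k - 1) * (q k - q (k - 1)))
    (j : ℕ) (hj : j < m) (t : ℝ) (h1 : q j ≤ t) (h2 : t ≤ q (j + 1)) (i : ℕ) (hi : i ≤ m) :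
    a i * (t - q i) + b i ≤ a j * (t - q j) + b j := by
  have step : ∀ i, i < m → a (i + 1) * (t - q (i + 1)) + b (i + 1)
      = a i * (t - q i) + b i + (a (i + 1) - a i) * (t - q (i + 1)) := by
    intro i hi
    have := hb (i + 1) (by omega) (by omega)
    simp only [Nat.add_sub_cancel] at this
    rw [this]; ring
  have up : ∀ n, j + n ≤ m → a (j + n) * (t - q (j + n)) + b (j + n) ≤ a j * (t - q j) + b j := by
    intro n
    induction n with
    | zero => intro _; simp
    | succ n ih =>
      intro h
      have e := step (j + n) (by omega)
      have := ih (by omega)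
      have hm := par_q_mono m q hq (j + 1) n (by omega)
      have h3 := ha (j + n) (by omega)
      rw [show j + 1 + n = j + n + 1 by omega] at hm
      rw [← add_assoc]
      nlinarith [mul_nonneg (sub_nonneg.2 h3.le) (sub_nonneg.2 (h2.trans hm))]
  have down : ∀ n i, i + n = j → a i * (t - q i) + b i ≤ a j * (t - q j) + b j := by
    intro n
    induction n with
    | zero => intro i h; simp at h; subst h; exact le_rfl
    | succ n ih =>
      intro i h
      have e := step i (by omega)
      have := ih (i + 1) (by omega)
      have hm := par_q_mono m q hq (i + 1) n (by omega)
      have h3 := ha i (by omega)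
      rw [show i + 1 + n = j by omega] at hm
      nlinarith [mul_nonneg (sub_nonneg.2 h3.le) (sub_nonneg.2 (hm.trans h1))]
  rcases le_total i j with h | h
  · exact down (j - i) i (by omega)
  · have := up (i - j) (by omega)
    rwa [show j + (i - j) = i by omega] at this

/-- First-order necessary condition for non-quantized minimizers:
let `f` be convex and differentiable, `λ > 0`, `w*` a minimizer of
`w ↦ f(w) + λΨ(w)`, and `k ∈ {1, …, m}`. If `q_{k-1} < w* < q_k`, then
`f'(w*) = −λ·a_{k-1}`; and if `−q_k < w* < −q_{k-1}`, then `f'(w*) = λ·a_{k-1}`. -/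
theorem par_necessary_nonquantized
    (m : ℕ) (hm : 1 ≤ m)
    (q a b : ℕ → ℝ)
    (hq0 : q 0 = 0)
    (hq : ∀ k, k < m → q k < q (k + 1))
    (ha0 : 0 ≤ a 0)
    (ha : ∀ k, k < m → a k < a (k + 1))
    (hb0 : b 0 = 0)
    (hb : ∀ k, 1 ≤ k → k ≤ m → b k = b (k - 1) + a (k - 1) * (q k - q (k - 1)))
    (Ψ : ℝ → ℝ)
    (hΨ : ∀ w, Ψ w = (Finset.range (m + 1)).sup'
      (Finset.nonempty_range_iff.mpr (Nat.succ_ne_zero m))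
      (fun k => a k * (|w| - q k) + b k))
    (f : ℝ → ℝ) (hfconv : ConvexOn ℝ Set.univ f) (hfdiff : Differentiable ℝ f)
    (lam : ℝ) (hlam : 0 < lam)
    (wstar : ℝ)
    (hmin : ∀ w : ℝ, f wstar + lam * Ψ wstar ≤ f w + lam * Ψ w)
    (k : ℕ) (hk1 : 1 ≤ k) (hkm : k ≤ m) :
    (q (k - 1) < wstar → wstar < q k → deriv f wstar = -(lam * a (k - 1))) ∧
    (-q k < wstar → wstar < -q (k - 1) → deriv f wstar = lam * a (k - 1)) := by
  obtain ⟨j, rfl⟩ : ∃ j, k = j + 1 := ⟨k - 1, by omega⟩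
  simp only [Nat.add_sub_cancel]
  have hqj : 0 ≤ q j := by
    have := par_q_mono m q hq 0 j (by omega)
    simpa [hq0] using this
  have key : ∀ w, q j ≤ |w| → |w| ≤ q (j + 1) → Ψ w = a j * (|w| - q j) + b j := by
    intro w h1 h2
    rw [hΨ]
    apply le_antisymm
    · apply Finset.sup'_le
      intro i hi
      exact par_piece m q a b hq ha hb j (by omega) _ h1 h2 i (by simp at hi; omega)
    · exact Finset.le_sup' (fun k => a k * (|w| - q k) + b k) (by simp; omega)
  have crit : ∀ c : ℝ, (∀ᶠ w in nhds wstar, f wstar + lam * (c * wstar) ≤ f w + lam * (c * w)) →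
      deriv f wstar = -(lam * c) := by
    intro c h
    have hd : HasDerivAt (fun w => f w + lam * (c * w)) (deriv f wstar + lam * (c * 1)) wstar :=
      (hfdiff wstar).hasDerivAt.add (((hasDerivAt_id wstar).const_mul c).const_mul lam)
    have hl : IsLocalMin (fun w => f w + lam * (c * w)) wstar := h
    have := hl.hasDerivAt_eq_zero hd
    linarith
  constructor
  · intro h1 h2
    apply crit
    filter_upwards [Ioo_mem_nhds h1 h2] with w hw
    have e : ∀ w, q j < w → w < q (j + 1) → Ψ w = a j * (w - q j) + b j := by
      intro w h1 h2
      have := key w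
      rw [abs_of_pos (by linarith)] at this
      exact this h1.le h2.le
    have := hmin w
    rw [e w hw.1 hw.2, e wstar h1 h2] at this
    linarith
  · intro h1 h2
    have := crit (-a j) ?_
    · linarith
    filter_upwards [Ioo_mem_nhds h1 h2] with w hw
    have e : ∀ w, -q (j + 1) < w → w < -q j → Ψ w = a j * (-w - q j) + b j := by
      intro w h1 h2
      have := key w
      rw [abs_of_neg (by linarith)] at this
      exact this (by linarith) (by linarith)
    have := hmin w
    rw [e w hw.1 hw.2, e wstar h1 h2] at this
    linarith
end

section
/- The aggregate proximal map of PAR with scaled input converges to the hard-quantization map: let λ > 0, let k ∈ {0, 1, …, m}, and let s ∈ ℝ satisfy λ·a_{k-1} < |s| < λ·a_k. Then there exists γ₀ > 0 such that for every γ ≥ γ₀, the function w ↦ γλΨ(w) + (1/2)(w − γs)² has a unique minimizer over ℝ, and this minimizer equals sgn(s)·q_k. -/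
/-- The aggregate proximal map of PAR with scaled input converges to the
hard-quantization map: let `λ > 0`, `k ∈ {0, …, m}`, and `s` satisfy
`λ·a_{k-1} < |s| < λ·a_k` (with the convention `a_{-1} = 0`). Then there exists
`γ₀ > 0` such that for every `γ ≥ γ₀`, the function `w ↦ γλΨ(w) + (1/2)(w − γs)²`
has a unique minimizer over ℝ, and this minimizer equals `sgn(s)·q_k`. -/
theorem par_aggregate_prox_hard_quantization
    (m : ℕ) (hm : 1 ≤ m)
    (q a b : ℕ → ℝ)
    (hq0 : q 0 = 0)
    (hq : ∀ k, k < m → q k < q (k + 1))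
    (ha0 : 0 ≤ a 0)
    (ha : ∀ k, k < m → a k < a (k + 1))
    (hb0 : b 0 = 0)
    (hb : ∀ k, 1 ≤ k → k ≤ m → b k = b (k - 1) + a (k - 1) * (q k - q (k - 1)))
    (Ψ : ℝ → ℝ)
    (hΨ : ∀ w, Ψ w = (Finset.range (m + 1)).sup'
      (Finset.nonempty_range_iff.mpr (Nat.succ_ne_zero m))
      (fun k => a k * (|w| - q k) + b k))
    (lam : ℝ) (hlam : 0 < lam)
    (k : ℕ) (hk : k ≤ m) (s : ℝ)
    (hlo : (if k = 0 then (0 : ℝ) else lam * a (k - 1)) < |s|)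
    (hhi : |s| < lam * a k) :
    ∃ γ₀ : ℝ, 0 < γ₀ ∧ ∀ γ : ℝ, γ₀ ≤ γ →
      ∀ v : ℝ, v ≠ Real.sign s * q k →
        γ * lam * Ψ (Real.sign s * q k) + (1 / 2) * (Real.sign s * q k - γ * s) ^ 2
          < γ * lam * Ψ v + (1 / 2) * (v - γ * s) ^ 2 := by
  have hb' : ∀ j, j < m → b (j + 1) = b j + a j * (q (j + 1) - q j) := by
    intro j hj
    have := hb (j + 1) (by omega) (by omega)
    simpa using this
  have am : ∀ j n, j + n ≤ m → a j ≤ a (j + n) := by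
    intro j n
    induction n with
    | zero => intro _; exact le_refl _
    | succ n ih =>
      intro h
      have h1 := ih (by omega)
      have h2 := ha (j + n) (by omega)
      rw [← Nat.add_assoc]; linarith
  have qm : ∀ j n, j + n ≤ m → q j ≤ q (j + n) := by
    intro j n
    induction n with
    | zero => intro _; exact le_refl _
    | succ n ih =>
      intro h
      have h1 := ih (by omega)
      have h2 := hq (j + n) (by omega)
      rw [← Nat.add_assoc]; linarith
  have cA : ∀ j n, j + n ≤ m → a j * (q (j + n) - q j) + b j ≤ b (j + n) := by
    intro j n
    induction n with
    | zero => intro _; simp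
    | succ n ih =>
      intro h
      have h1 := ih (by omega)
      have h2 := hq (j + n) (by omega)
      have h3 := am j n (by omega)
      have h4 := hb' (j + n) (by omega)
      rw [← Nat.add_assoc]
      nlinarith [mul_nonneg (sub_nonneg.2 h3) (sub_nonneg.2 h2.le)]
  have cB : ∀ n, k + n ≤ m → a (k + n) * (q k - q (k + n)) + b (k + n) ≤ b k := by
    intro n
    induction n with
    | zero => intro _; simp
    | succ n ih =>
      intro h
      have h1 := ih (by omega)
      have h2 := qm k (n + 1) h
      have h3 := ha (k + n) (by omega)
      have h4 := hb' (k + n) (by omega)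
      rw [← Nat.add_assoc] at h2 ⊢
      nlinarith [mul_nonneg (sub_nonneg.2 h3.le) (sub_nonneg.2 h2)]
  have hqk : 0 ≤ q k := by
    have := qm 0 k (by omega)
    rw [Nat.zero_add, hq0] at this; exact this
  have hlb : ∀ w j, j ≤ m → a j * (|w| - q j) + b j ≤ Ψ w := by
    intro w j hj
    rw [hΨ]
    exact Finset.le_sup' (fun k => a k * (|w| - q k) + b k)
      (Finset.mem_range.2 (by omega))
  have hub : ∀ w, |w| = q k → Ψ w ≤ b k := by
    intro w hw
    rw [hΨ]
    apply Finset.sup'_le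
    intro j hj
    have hj := Finset.mem_range.1 hj
    rw [hw]
    rcases le_total j k with h | h
    · obtain ⟨n, rfl⟩ := Nat.exists_eq_add_of_le h
      exact cA j n hk
    · obtain ⟨n, rfl⟩ := Nat.exists_eq_add_of_le h
      exact cB n (by omega)
  have hs : 0 < |s| := by
    split_ifs at hlo with h
    · exact hlo
    · have h1 := am 0 (k - 1) (by omega)
      rw [Nat.zero_add] at h1
      have := mul_nonneg hlam.le (ha0.trans h1)
      linarith
  have hs0 : s ≠ 0 := abs_pos.1 hs
  have hsg : s * Real.sign s = |s| ∧ |Real.sign s| = 1 := by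
    rcases lt_or_gt_of_ne hs0 with h | h
    · rw [Real.sign_of_neg h, abs_of_neg h]; simp
    · rw [Real.sign_of_pos h, abs_of_pos h]; simp
  obtain ⟨hsg1, hsg2⟩ := hsg
  have hw : |Real.sign s * q k| = q k := by
    rw [abs_mul, hsg2, one_mul, abs_of_nonneg hqk]
  have hΨw := hub _ hw
  have hw2 : (Real.sign s * q k) ^ 2 = q k ^ 2 := by rw [← sq_abs, hw]
  have hsw : s * (Real.sign s * q k) = |s| * q k := by rw [← mul_assoc, hsg1]
  generalize Real.sign s * q k = w at *
  set c := (if k = 0 then (0 : ℝ) else lam * a (k - 1)) with hc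
  have hd : 0 < |s| - c := by linarith
  refine ⟨q k / (|s| - c) + 1, by positivity, ?_⟩
  intro γ hγ v hv
  have hγ0 : 0 < γ := lt_of_lt_of_le (by positivity) hγ
  have hγq : q k < γ * (|s| - c) := by
    rw [← div_lt_iff₀ hd]; linarith
  have hsv : s * v ≤ |s| * |v| := by rw [← abs_mul]; exact le_abs_self _
  have hv2 : v ^ 2 = |v| ^ 2 := (sq_abs v).symm
  have hgl : 0 < γ * lam := by positivity
  have e1 : γ * lam * Ψ w ≤ γ * lam * b k := mul_le_mul_of_nonneg_left hΨw hgl.le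
  have e2 : γ * (s * v) ≤ γ * (|s| * |v|) := mul_le_mul_of_nonneg_left hsv hγ0.le
  have e3 : γ * (s * w) = γ * (|s| * q k) := by rw [hsw]
  rcases lt_trichotomy (q k) |v| with h | h | h
  · have e4 := mul_le_mul_of_nonneg_left (hlb v k hk) hgl.le
    have e5 : 0 < γ * (lam * a k - |s|) * (|v| - q k) :=
      mul_pos (mul_pos hγ0 (by linarith)) (by linarith)
    have e6 : q k ^ 2 ≤ |v| ^ 2 := by gcongr
    nlinarith
  · have e4 := mul_le_mul_of_nonneg_left (hlb v k hk) hgl.le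
    rw [← h, sub_self, mul_zero, zero_add] at e4
    have hne : s * v ≠ s * w := fun hh => hv (mul_left_cancel₀ hs0 hh)
    rw [← h] at hsv hv2
    have e5 : s * v < s * w := lt_of_le_of_ne (by linarith) hne
    have e6 := mul_lt_mul_of_pos_left e5 hγ0
    nlinarith
  · have hk0 : k ≠ 0 := by
      rintro rfl
      rw [hq0] at h
      linarith [abs_nonneg v]
    rw [if_neg hk0] at hc
    have e4 := mul_le_mul_of_nonneg_left (hlb v (k - 1) (by omega)) hgl.le
    have hbk := hb k (by omega) hk
    have e7 : a (k - 1) * (|v| - q (k - 1)) + b (k - 1) = a (k - 1) * (|v| - q k) + b k := by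
      rw [hbk]; ring
    rw [e7] at e4
    have e8 : γ * lam * (a (k - 1) * (|v| - q k) + b k) = γ * c * (|v| - q k) + γ * lam * b k := by
      rw [hc]; ring
    rw [e8] at e4
    have e5 : 0 < (γ * (|s| - c) - q k) * (q k - |v|) :=
      mul_pos (by linarith) (by linarith)
    nlinarith [sq_nonneg (q k - |v|)]
end

section
/- Regret bound for AProx (Theorem 3 of the paper): for every w ∈ E and every integer t ≥ 1, Σ_{s=1}^t η_s ( f_s(w^s) + λΨ(w^s) − f_s(w) − λΨ(w) ) ≤ ((G_f + λ G_Ψ)² / ρ) · Σ_{s=1}^t η_s² + D_h(w, w^0). -/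
open RealInnerProductSpace

/-- Quadratic growth at a minimizer of a strongly convex function. -/
theorem sc_growth {E : Type*} [NormedAddCommGroup E] [InnerProductSpace ℝ E]
    (φ : E → ℝ) (ρ : ℝ) (hφ : StrongConvexOn Set.univ ρ φ) (a : E)
    (ha : ∀ y, φ a ≤ φ y) (y : E) : φ a + ρ / 2 * ‖a - y‖ ^ 2 ≤ φ y := by
  have key : ∀ c : ℝ, 0 < c → c < 1 → φ a + (1 - c) * (ρ / 2 * ‖a - y‖ ^ 2) ≤ φ y := by
    intro c hc0 hc1
    have h1 := hφ.2 (Set.mem_univ a) (Set.mem_univ y)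
      (show 0 ≤ 1 - c by linarith) hc0.le (by ring)
    have h2 := ha ((1 - c) • a + c • y)
    simp only [smul_eq_mul] at h1
    have h3 : 0 ≤ c * (φ y - φ a - (1 - c) * (ρ / 2 * ‖a - y‖ ^ 2)) := by nlinarith
    have := nonneg_of_mul_nonneg_right h3 hc0
    linarith
  by_contra hcon
  push Not at hcon
  have ht : Filter.Tendsto (fun c : ℝ => φ a + (1 - c) * (ρ / 2 * ‖a - y‖ ^ 2))
      (nhdsWithin 0 (Set.Ioi 0)) (nhds (φ a + (1 - 0) * (ρ / 2 * ‖a - y‖ ^ 2))) := by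
    apply tendsto_nhdsWithin_of_tendsto_nhds
    exact Continuous.tendsto (by fun_prop) 0
  have hle : φ a + (1 - 0) * (ρ / 2 * ‖a - y‖ ^ 2) ≤ φ y := by
    apply le_of_tendsto ht
    filter_upwards [Ioo_mem_nhdsGT (show (0:ℝ) < 1 by norm_num)] with c hc
    exact key c hc.1 hc.2
  linarith

/-- Gradient inequality. -/
theorem grad_ineq {E : Type*} [NormedAddCommGroup E] [InnerProductSpace ℝ E]
    (h : E → ℝ) (hd : Differentiable ℝ h) (hc : ConvexOn ℝ Set.univ h) (a y : E) :
    0 ≤ h y - h a - fderiv ℝ h a (y - a) := by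
  have hconv : ConvexOn ℝ Set.univ (fun c : ℝ => h (AffineMap.lineMap a y c)) := by
    have := hc.comp_affineMap (AffineMap.lineMap (k := ℝ) a y)
    simpa [Function.comp_def] using this
  have hder : HasDerivAt (fun c : ℝ => h (AffineMap.lineMap a y c)) (fderiv ℝ h a (y - a)) 0 := by
    have h1 : HasDerivAt (fun c : ℝ => AffineMap.lineMap a y c) (y - a) 0 :=
      AffineMap.hasDerivAt_lineMap
    have h2 : HasFDerivAt h (fderiv ℝ h a) (AffineMap.lineMap a y (0:ℝ)) := by
      simpa using (hd a).hasFDerivAt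
    exact h2.comp_hasDerivAt (0:ℝ) h1
  have := hconv.le_slope_of_hasDerivAt (Set.mem_univ 0) (Set.mem_univ 1) (by norm_num) hder
  simp [slope_def_field] at this
  simp only [map_sub]
  linarith

/-- Regret bound for AProx (Theorem 3 of the paper): for every `w ∈ E`
and every integer `t ≥ 1`,
`Σ_{s=1}^t η_s ( f_s(w^s) + λΨ(w^s) − f_s(w) − λΨ(w) )
  ≤ ((G_f + λ G_Ψ)² / ρ) · Σ_{s=1}^t η_s² + D_h(w, w^0)`. -/
theorem aprox_regret_bound
    {E : Type*} [NormedAddCommGroup E] [InnerProductSpace ℝ E] [FiniteDimensional ℝ E]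
    (Ψ : E → ℝ) (GΨ : ℝ) (hGΨ : 0 ≤ GΨ)
    (hΨconv : ConvexOn ℝ Set.univ Ψ)
    (hΨlip : ∀ x y : E, |Ψ x - Ψ y| ≤ GΨ * ‖x - y‖)
    (lam : ℝ) (hlam : 0 ≤ lam)
    (Gf : ℝ) (hGf : 0 ≤ Gf)
    (ρ : ℝ) (hρ : 0 < ρ)
    (h : E → ℝ) (hhdiff : Differentiable ℝ h)
    (hhsc : StrongConvexOn Set.univ ρ h)
    (Dh : E → E → ℝ)
    (hDh : ∀ u v : E, Dh u v = h u - h v - fderiv ℝ h v (u - v))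
    (f : ℕ → E → ℝ)
    (hfconv : ∀ t, 1 ≤ t → ConvexOn ℝ Set.univ (f t))
    (hflip : ∀ t, 1 ≤ t → ∀ x y : E, |f t x - f t y| ≤ Gf * ‖x - y‖)
    (η : ℕ → ℝ) (hη : ∀ t, 1 ≤ t → 0 < η t)
    (w g : ℕ → E)
    (hw1 : w 1 = w 0)
    (hsub : ∀ s, 1 ≤ s → ∀ y : E, f s (w s) + ⟪g s, y - w s⟫ ≤ f s y)
    (hgnorm : ∀ s, 1 ≤ s → ‖g s‖ ≤ Gf)
    (hiter : ∀ t, 1 ≤ t → ∀ y : E,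
      (∑ s ∈ Finset.Icc 1 t, η s * (⟪g s, w (t + 1)⟫ + lam * Ψ (w (t + 1))))
          + Dh (w (t + 1)) (w 0)
        ≤ (∑ s ∈ Finset.Icc 1 t, η s * (⟪g s, y⟫ + lam * Ψ y)) + Dh y (w 0)) :
    ∀ (x : E) (t : ℕ), 1 ≤ t →
      ∑ s ∈ Finset.Icc 1 t,
          η s * (f s (w s) + lam * Ψ (w s) - f s x - lam * Ψ x)
        ≤ ((Gf + lam * GΨ) ^ 2 / ρ) * ∑ s ∈ Finset.Icc 1 t, (η s) ^ 2
          + Dh x (w 0) := by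
  intro x t ht
  set G := Gf + lam * GΨ with hG
  let ell : ℕ → E → ℝ := fun s y => η s * (⟪g s, y⟫ + lam * Ψ y)
  let Φ : ℕ → E → ℝ := fun t y => (∑ s ∈ Finset.Icc 1 t, ell s y) + Dh y (w 0)
  have hhc : ConvexOn ℝ Set.univ h := by
    have := hhsc.mono hρ.le
    exact strongConvexOn_zero.1 this
  have hDmin : ∀ y, 0 ≤ Dh y (w 0) := fun y => by
    rw [hDh]; exact grad_ineq h hhdiff hhc _ _
  have hell : ∀ s, 1 ≤ s → ConvexOn ℝ Set.univ (ell s) := by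
    intro s hs
    have h1 : ConvexOn ℝ Set.univ (fun y : E => ⟪g s, y⟫) :=
      (innerSL ℝ (g s)).toLinearMap.convexOn convex_univ
    exact (h1.add (hΨconv.smul hlam)).smul (hη s hs).le
  have hsum : ∀ t, ConvexOn ℝ Set.univ (fun y => ∑ s ∈ Finset.Icc 1 t, ell s y) := by
    intro t
    induction t with
    | zero => simpa using convexOn_const (0:ℝ) convex_univ
    | succ n ih =>
      simp_rw [Finset.sum_Icc_succ_top (show 1 ≤ n + 1 by omega)]
      exact ih.add (hell _ (by omega))
  have hlin : ConvexOn ℝ Set.univ (fun y : E => - h (w 0) - fderiv ℝ h (w 0) (y - w 0)) := by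
    have h1 : ConvexOn ℝ Set.univ (fun y : E => (-(fderiv ℝ h (w 0))) y) :=
      (-(fderiv ℝ h (w 0))).toLinearMap.convexOn convex_univ
    have h2 := h1.add (convexOn_const (- h (w 0) + fderiv ℝ h (w 0) (w 0)) convex_univ)
    have h3 : (fun y : E => - h (w 0) - fderiv ℝ h (w 0) (y - w 0)) =
        (fun y : E => (-(fderiv ℝ h (w 0))) y) +
          fun _ => (- h (w 0) + fderiv ℝ h (w 0) (w 0)) := by
      funext y
      simp only [Pi.add_apply, map_sub, neg_apply]; ring
    rw [h3]; exact h2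
  have hΦsc : ∀ t, StrongConvexOn Set.univ ρ (Φ t) := by
    intro t
    have h1 := (hsum t).add hlin
    refine ⟨convex_univ, fun u _ v _ a b ha hb hab => ?_⟩
    have e1 := h1.2 (Set.mem_univ u) (Set.mem_univ v) ha hb hab
    have e2 := hhsc.2 (Set.mem_univ u) (Set.mem_univ v) ha hb hab
    simp only [Pi.add_apply, smul_eq_mul] at e1 e2
    simp only [Φ, hDh, smul_eq_mul]
    linarith
  have hmin : ∀ t y, Φ t (w (t + 1)) ≤ Φ t y := by
    intro t y
    rcases Nat.eq_zero_or_pos t with rfl | hpos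
    · simp only [Φ, zero_add, hw1]
      simpa [hDh (w 0) (w 0)] using hDmin y
    · exact hiter t hpos y
  have hlip : ∀ s, 1 ≤ s → ∀ u v, ell s u - ell s v ≤ η s * G * ‖u - v‖ := by
    intro s hs u v
    have h1 : ⟪g s, u - v⟫ ≤ Gf * ‖u - v‖ :=
      (real_inner_le_norm _ _).trans (mul_le_mul_of_nonneg_right (hgnorm s hs) (norm_nonneg _))
    rw [inner_sub_right] at h1
    have h2 := mul_le_mul_of_nonneg_left ((le_abs_self _).trans (hΨlip u v)) hlam
    have h3 : ⟪g s, u⟫ + lam * Ψ u - (⟪g s, v⟫ + lam * Ψ v) ≤ G * ‖u - v‖ := by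
      rw [hG]; linarith
    have := mul_le_mul_of_nonneg_left h3 (hη s hs).le
    simp only [ell]; linarith
  have main : ∀ t, ∑ s ∈ Finset.Icc 1 t, ell s (w s)
      ≤ Φ t (w (t + 1)) + G ^ 2 / ρ * ∑ s ∈ Finset.Icc 1 t, (η s) ^ 2 := by
    intro t
    induction t with
    | zero => simpa [Φ] using hDmin _
    | succ n ih =>
      have e1 := sc_growth (Φ n) ρ (hΦsc n) (w (n + 1)) (hmin n) (w (n + 1 + 1))
      have e2 := hlip (n + 1) (by omega) (w (n + 1)) (w (n + 1 + 1))
      have e3 : Φ (n + 1) (w (n + 1 + 1)) = Φ n (w (n + 1 + 1)) + ell (n + 1) (w (n + 1 + 1)) := by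
        simp only [Φ]
        rw [Finset.sum_Icc_succ_top (by omega)]; ring
      rw [e3, Finset.sum_Icc_succ_top (by omega), Finset.sum_Icc_succ_top (by omega)]
      have e4 : η (n + 1) * G * ‖w (n + 1) - w (n + 1 + 1)‖
          ≤ ρ / 2 * ‖w (n + 1) - w (n + 1 + 1)‖ ^ 2 + G ^ 2 / ρ * η (n + 1) ^ 2 := by
        generalize ‖w (n + 1) - w (n + 1 + 1)‖ = d
        have : ρ / 2 * d ^ 2 + G ^ 2 / ρ * η (n + 1) ^ 2 - η (n + 1) * G * d
            = ((ρ * d - η (n + 1) * G) ^ 2 + (η (n + 1) * G) ^ 2) / (2 * ρ) := by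
          field_simp; ring
        have : 0 ≤ ((ρ * d - η (n + 1) * G) ^ 2 + (η (n + 1) * G) ^ 2) / (2 * ρ) := by positivity
        linarith
      linarith
  have hfin : ∑ s ∈ Finset.Icc 1 t, η s * (f s (w s) + lam * Ψ (w s) - f s x - lam * Ψ x)
      ≤ ∑ s ∈ Finset.Icc 1 t, ell s (w s) - ∑ s ∈ Finset.Icc 1 t, ell s x := by
    rw [← Finset.sum_sub_distrib]
    apply Finset.sum_le_sum
    intro s hs
    have hs1 := (Finset.mem_Icc.1 hs).1
    have h1 := hsub s hs1 x
    rw [inner_sub_right] at h1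
    simp only [ell]
    rw [← mul_sub]
    apply mul_le_mul_of_nonneg_left _ (hη s hs1).le
    linarith
  have h1 := main t
  have h2 := hmin t x
  have h3 : Φ t x = (∑ s ∈ Finset.Icc 1 t, ell s x) + Dh x (w 0) := rfl
  linarith
end

section
/- Aggregate linearized-loss bound for AProx: for every w ∈ E and every integer t ≥ 1, Σ_{s=1}^t η_s ( ⟪g^s, w^{s+1}⟫ + λΨ(w^{s+1}) ) ≤ Σ_{s=1}^t η_s ( ⟪g^s, w⟫ + λΨ(w) ) + D_h(w, w^0). -/
open RealInnerProductSpace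

/-- Aggregate linearized-loss bound for AProx: for every `w ∈ E` and
every integer `t ≥ 1`,
`Σ_{s=1}^t η_s ( ⟪g^s, w^{s+1}⟫ + λΨ(w^{s+1}) )
  ≤ Σ_{s=1}^t η_s ( ⟪g^s, w⟫ + λΨ(w) ) + D_h(w, w^0)`. -/
theorem aprox_aggregate_linearized_bound
    {E : Type*} [NormedAddCommGroup E] [InnerProductSpace ℝ E] [FiniteDimensional ℝ E]
    (Ψ : E → ℝ) (GΨ : ℝ) (hGΨ : 0 ≤ GΨ)
    (hΨconv : ConvexOn ℝ Set.univ Ψ)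
    (hΨlip : ∀ x y : E, |Ψ x - Ψ y| ≤ GΨ * ‖x - y‖)
    (lam : ℝ) (hlam : 0 ≤ lam)
    (Gf : ℝ) (hGf : 0 ≤ Gf)
    (ρ : ℝ) (hρ : 0 < ρ)
    (h : E → ℝ) (hhdiff : Differentiable ℝ h)
    (hhsc : StrongConvexOn Set.univ ρ h)
    (Dh : E → E → ℝ)
    (hDh : ∀ u v : E, Dh u v = h u - h v - fderiv ℝ h v (u - v))
    (f : ℕ → E → ℝ)
    (hfconv : ∀ t, 1 ≤ t → ConvexOn ℝ Set.univ (f t))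
    (hflip : ∀ t, 1 ≤ t → ∀ x y : E, |f t x - f t y| ≤ Gf * ‖x - y‖)
    (η : ℕ → ℝ) (hη : ∀ t, 1 ≤ t → 0 < η t)
    (w g : ℕ → E)
    (hw1 : w 1 = w 0)
    (hsub : ∀ s, 1 ≤ s → ∀ y : E, f s (w s) + ⟪g s, y - w s⟫ ≤ f s y)
    (hgnorm : ∀ s, 1 ≤ s → ‖g s‖ ≤ Gf)
    (hiter : ∀ t, 1 ≤ t → ∀ y : E,
      (∑ s ∈ Finset.Icc 1 t, η s * (⟪g s, w (t + 1)⟫ + lam * Ψ (w (t + 1))))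
          + Dh (w (t + 1)) (w 0)
        ≤ (∑ s ∈ Finset.Icc 1 t, η s * (⟪g s, y⟫ + lam * Ψ y)) + Dh y (w 0)) :
    ∀ (x : E) (t : ℕ), 1 ≤ t →
      ∑ s ∈ Finset.Icc 1 t, η s * (⟪g s, w (s + 1)⟫ + lam * Ψ (w (s + 1)))
        ≤ (∑ s ∈ Finset.Icc 1 t, η s * (⟪g s, x⟫ + lam * Ψ x)) + Dh x (w 0) := by
  have hc : ConvexOn ℝ Set.univ h := by
    refine UniformConvexOn.convexOn hhsc ?_
    intro r; dsimp; positivity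
  have hD : ∀ u v : E, 0 ≤ Dh u v := by
    intro u v
    rw [hDh]
    have hφ : ConvexOn ℝ Set.univ (h ∘ (AffineMap.lineMap v u : ℝ →ᵃ[ℝ] E)) := by
      simpa using hc.comp_affineMap (AffineMap.lineMap v u : ℝ →ᵃ[ℝ] E)
    have hd : HasDerivAt (h ∘ (AffineMap.lineMap v u : ℝ →ᵃ[ℝ] E))
        (fderiv ℝ h v (u - v)) 0 := by
      have h1 : HasFDerivAt h (fderiv ℝ h v) ((AffineMap.lineMap v u : ℝ →ᵃ[ℝ] E) 0) := by
        simpa using (hhdiff v).hasFDerivAt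
      exact h1.comp_hasDerivAt (0 : ℝ) AffineMap.hasDerivAt_lineMap
    have h2 := hφ.le_slope_of_hasDerivAt (Set.mem_univ 0) (Set.mem_univ 1) one_pos hd
    simp [slope_def_field] at h2
    rw [map_sub]
    linarith
  have key : ∀ (t : ℕ) (x : E),
      ∑ s ∈ Finset.Icc 1 t, η s * (⟪g s, w (s + 1)⟫ + lam * Ψ (w (s + 1)))
        ≤ (∑ s ∈ Finset.Icc 1 t, η s * (⟪g s, x⟫ + lam * Ψ x)) + Dh x (w 0) := by
    intro t
    induction t with
    | zero => intro x; simpa using hD x (w 0)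
    | succ t ih =>
      intro x
      refine le_trans ?_ (hiter (t + 1) (by omega) x)
      have h3 := ih (w (t + 1 + 1))
      rw [Finset.sum_Icc_succ_top (by omega), Finset.sum_Icc_succ_top (by omega)]
      linarith
  exact fun x t _ => key t x
end

section
/- Iterate stability of AProx: for every integer t ≥ 1, ‖w^{t+1} − w^t‖ ≤ η_t (G_f + λ G_Ψ) / ρ. -/
open RealInnerProductSpace

lemma aux_growth {E : Type*} [NormedAddCommGroup E] [InnerProductSpace ℝ E]
    {F : E → ℝ} {ρ : ℝ} (hF : StrongConvexOn Set.univ ρ F) {x : E} (hx : ∀ y, F x ≤ F y) (y : E) :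
    F x + ρ / 2 * ‖y - x‖ ^ 2 ≤ F y := by
  have key : ∀ a : ℝ, 0 < a → a < 1 → F x + (1 - a) * (ρ / 2 * ‖y - x‖ ^ 2) ≤ F y := by
    intro a ha ha1
    have h1 := hF.2 (Set.mem_univ y) (Set.mem_univ x) ha.le (sub_nonneg.2 ha1.le) (by ring)
    have h2 := hx (a • y + (1 - a) • x)
    simp only [smul_eq_mul] at h1
    have h3 : 0 ≤ a * (F y - (F x + (1 - a) * (ρ / 2 * ‖y - x‖ ^ 2))) := by linarith
    have := nonneg_of_mul_nonneg_right h3 ha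
    linarith
  have ht : Filter.Tendsto (fun a : ℝ => F x + (1 - a) * (ρ / 2 * ‖y - x‖ ^ 2))
      (nhdsWithin 0 (Set.Ioi 0)) (nhds (F x + (1 - 0) * (ρ / 2 * ‖y - x‖ ^ 2))) := by
    apply Filter.Tendsto.mono_left _ nhdsWithin_le_nhds
    apply Continuous.tendsto
    fun_prop
  have := le_of_tendsto ht (b := F y) (by
    filter_upwards [Ioo_mem_nhdsGT (zero_lt_one (α := ℝ))] with a ha
    exact key a ha.1 ha.2)
  linarith

lemma aux_grad {E : Type*} [NormedAddCommGroup E] [InnerProductSpace ℝ E]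
    {h : E → ℝ} (hc : ConvexOn ℝ Set.univ h) (hd : Differentiable ℝ h) (x y : E) :
    0 ≤ h y - h x - fderiv ℝ h x (y - x) := by
  have hl : HasDerivAt (fun a : ℝ => x + a • (y - x)) (y - x) 0 := by
    simpa using ((hasDerivAt_id (0 : ℝ)).smul_const (y - x)).const_add x
  have h1 : HasDerivAt (fun a : ℝ => h (x + a • (y - x))) (fderiv ℝ h x (y - x)) 0 := by
    have hx : HasFDerivAt h (fderiv ℝ h x) (x + (0 : ℝ) • (y - x)) := by
      simpa using (hd x).hasFDerivAt
    exact hx.comp_hasDerivAt (0 : ℝ) hl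
  have ht := h1.tendsto_slope_zero_right
  have := le_of_tendsto ht (b := h y - h x) (by
    filter_upwards [Ioo_mem_nhdsGT (zero_lt_one (α := ℝ))] with a ha
    have h2 := hc.2 (Set.mem_univ x) (Set.mem_univ y) (sub_nonneg.2 ha.2.le) ha.1.le (by ring)
    have e : (1 - a) • x + a • y = x + a • (y - x) := by module
    rw [e] at h2
    simp only [smul_eq_mul, zero_add, zero_smul, add_zero] at h2 ⊢
    rw [inv_mul_le_iff₀ ha.1]
    linarith)
  linarith


/-- Iterate stability of AProx: for every integer `t ≥ 1`,
`‖w^{t+1} − w^t‖ ≤ η_t (G_f + λ G_Ψ) / ρ`. -/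
theorem aprox_iterate_stability
    {E : Type*} [NormedAddCommGroup E] [InnerProductSpace ℝ E] [FiniteDimensional ℝ E]
    (Ψ : E → ℝ) (GΨ : ℝ) (hGΨ : 0 ≤ GΨ)
    (hΨconv : ConvexOn ℝ Set.univ Ψ)
    (hΨlip : ∀ x y : E, |Ψ x - Ψ y| ≤ GΨ * ‖x - y‖)
    (lam : ℝ) (hlam : 0 ≤ lam)
    (Gf : ℝ) (hGf : 0 ≤ Gf)
    (ρ : ℝ) (hρ : 0 < ρ)
    (h : E → ℝ) (hhdiff : Differentiable ℝ h)
    (hhsc : StrongConvexOn Set.univ ρ h)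
    (Dh : E → E → ℝ)
    (hDh : ∀ u v : E, Dh u v = h u - h v - fderiv ℝ h v (u - v))
    (f : ℕ → E → ℝ)
    (hfconv : ∀ t, 1 ≤ t → ConvexOn ℝ Set.univ (f t))
    (hflip : ∀ t, 1 ≤ t → ∀ x y : E, |f t x - f t y| ≤ Gf * ‖x - y‖)
    (η : ℕ → ℝ) (hη : ∀ t, 1 ≤ t → 0 < η t)
    (w g : ℕ → E)
    (hw1 : w 1 = w 0)
    (hsub : ∀ s, 1 ≤ s → ∀ y : E, f s (w s) + ⟪g s, y - w s⟫ ≤ f s y)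
    (hgnorm : ∀ s, 1 ≤ s → ‖g s‖ ≤ Gf)
    (hiter : ∀ t, 1 ≤ t → ∀ y : E,
      (∑ s ∈ Finset.Icc 1 t, η s * (⟪g s, w (t + 1)⟫ + lam * Ψ (w (t + 1))))
          + Dh (w (t + 1)) (w 0)
        ≤ (∑ s ∈ Finset.Icc 1 t, η s * (⟪g s, y⟫ + lam * Ψ y)) + Dh y (w 0)) :
    ∀ t : ℕ, 1 ≤ t →
      ‖w (t + 1) - w t‖ ≤ η t * (Gf + lam * GΨ) / ρ := by
  intro t ht
  obtain ⟨n, rfl⟩ : ∃ n, t = n + 1 := ⟨t - 1, by omega⟩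
  set F : ℕ → E → ℝ := fun t y =>
    (∑ s ∈ Finset.Icc 1 t, η s * (⟪g s, y⟫ + lam * Ψ y)) + Dh y (w 0) with hFdef
  have hsc : ∀ t, StrongConvexOn Set.univ ρ (F t) := by
    intro t
    refine ⟨convex_univ, ?_⟩
    intro x _ y _ a b ha hb hab
    have h1 := hhsc.2 (Set.mem_univ x) (Set.mem_univ y) ha hb hab
    have h2 := hΨconv.2 (Set.mem_univ x) (Set.mem_univ y) ha hb hab
    simp only [smul_eq_mul] at h1 h2 ⊢
    have h3 : (∑ s ∈ Finset.Icc 1 t, η s * (⟪g s, a • x + b • y⟫ + lam * Ψ (a • x + b • y)))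
        ≤ a * (∑ s ∈ Finset.Icc 1 t, η s * (⟪g s, x⟫ + lam * Ψ x))
          + b * (∑ s ∈ Finset.Icc 1 t, η s * (⟪g s, y⟫ + lam * Ψ y)) := by
      rw [Finset.mul_sum, Finset.mul_sum, ← Finset.sum_add_distrib]
      apply Finset.sum_le_sum
      intro s hs
      have hs' := hη s (Finset.mem_Icc.1 hs).1
      have h4 := mul_le_mul_of_nonneg_left h2 hlam
      rw [inner_add_right, inner_smul_right, inner_smul_right]
      have := mul_le_mul_of_nonneg_left (add_le_add_right h4 (a * ⟪g s, x⟫ + b * ⟪g s, y⟫)) hs'.le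
      refine this.trans (le_of_eq (by ring))
    have h5 : fderiv ℝ h (w 0) (a • x + b • y - w 0)
        = a * fderiv ℝ h (w 0) (x - w 0) + b * fderiv ℝ h (w 0) (y - w 0) := by
      simp only [map_sub, map_add, map_smul, smul_eq_mul]
      linear_combination (fderiv ℝ h (w 0) (w 0)) * hab
    simp only [hFdef, hDh, h5]
    have e : h (w 0) = a * h (w 0) + b * h (w 0) := by rw [← add_mul, hab, one_mul]
    linarith
  have hmin : ∀ t y, F t (w (t + 1)) ≤ F t y := by
    intro t y
    rcases Nat.eq_zero_or_pos t with rfl | hp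
    · have := aux_grad (hhsc.strictConvexOn hρ).convexOn hhdiff (w 0) y
      simpa [hFdef, hDh, hw1] using this
    · exact hiter t hp y
  have g1 := aux_growth (hsc n) (hmin n) (w (n + 1 + 1))
  have g2 := aux_growth (hsc (n + 1)) (hmin (n + 1)) (w (n + 1))
  have hstep : ∀ y, F (n + 1) y = F n y + η (n + 1) * (⟪g (n + 1), y⟫ + lam * Ψ y) := by
    intro y
    simp only [hFdef]
    rw [Finset.sum_Icc_succ_top (by omega)]
    ring
  rw [hstep, hstep, norm_sub_rev] at g2
  set d := ‖w (n + 1 + 1) - w (n + 1)‖ with hd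
  have hη' := hη _ ht
  have b1 : ⟪g (n + 1), w (n + 1)⟫ - ⟪g (n + 1), w (n + 1 + 1)⟫ ≤ Gf * d := by
    rw [← inner_sub_right, hd, norm_sub_rev]
    exact (real_inner_le_norm _ _).trans
      (mul_le_mul_of_nonneg_right (hgnorm _ ht) (norm_nonneg _))
  have b2 : lam * (Ψ (w (n + 1)) - Ψ (w (n + 1 + 1))) ≤ lam * (GΨ * d) := by
    apply mul_le_mul_of_nonneg_left _ hlam
    rw [hd, norm_sub_rev]
    exact (le_abs_self _).trans (hΨlip _ _)
  have b3 := mul_le_mul_of_nonneg_left (add_le_add b1 b2) hη'.le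
  have b4 : d * (ρ * d) ≤ d * (η (n + 1) * (Gf + lam * GΨ)) := by linarith
  rw [le_div_iff₀ hρ]
  rcases (norm_nonneg (w (n + 1 + 1) - w (n + 1))).eq_or_lt with h0 | h0
  · rw [hd, ← h0, zero_mul]
    positivity
  · have := le_of_mul_le_mul_left b4 h0
    linarith
end

section
/- Per-step progress bound for AProx: for every integer t ≥ 1, ⟪g^t, w^t − w^{t+1}⟫ + λΨ(w^t) − λΨ(w^{t+1}) ≤ η_t (G_f + λ G_Ψ)² / ρ. -/
open RealInnerProductSpace

theorem quad_growth {E : Type*} [NormedAddCommGroup E] [InnerProductSpace ℝ E]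
    (F : E → ℝ) (ρ : ℝ) (hF : StrongConvexOn Set.univ ρ F) (x : E) (hx : ∀ y, F x ≤ F y) (y : E) :
    F x + ρ / 2 * ‖x - y‖ ^ 2 ≤ F y := by
  have key : ∀ t : ℝ, 0 < t → t < 1 → (1 - t) * (ρ / 2 * ‖x - y‖ ^ 2) ≤ F y - F x := by
    intro t h0 h1
    have h2 := hF.2 (Set.mem_univ x) (Set.mem_univ y) (by linarith : 0 ≤ 1 - t) h0.le (by ring)
    have h3 := hx ((1 - t) • x + t • y)
    simp only [smul_eq_mul] at h2
    have : t * ((1 - t) * (ρ / 2 * ‖x - y‖ ^ 2)) ≤ t * (F y - F x) := by nlinarith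
    exact le_of_mul_le_mul_left this h0
  have ht : Filter.Tendsto (fun t : ℝ => (1 - t) * (ρ / 2 * ‖x - y‖ ^ 2)) (nhdsWithin 0 (Set.Ioi 0))
      (nhds ((1 - 0) * (ρ / 2 * ‖x - y‖ ^ 2))) := by
    apply Filter.Tendsto.mono_left _ nhdsWithin_le_nhds
    apply Continuous.tendsto
    fun_prop
  have := le_of_tendsto ht (b := F y - F x) (by
    filter_upwards [Ioo_mem_nhdsGT (zero_lt_one' ℝ)] with t ht
    exact key t ht.1 ht.2)
  linarith

theorem tangent_le {E : Type*} [NormedAddCommGroup E] [InnerProductSpace ℝ E]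
    (h : E → ℝ) (hd : Differentiable ℝ h) (hc : ConvexOn ℝ Set.univ h) (x y : E) :
    h x + fderiv ℝ h x (y - x) ≤ h y := by
  have h1 : ConvexOn ℝ Set.univ (fun t : ℝ => h (AffineMap.lineMap x y t)) :=
    hc.comp_affineMap (AffineMap.lineMap x y)
  have h2 : HasDerivAt (fun t : ℝ => h (AffineMap.lineMap x y t)) (fderiv ℝ h x (y - x)) 0 := by
    have a : HasFDerivAt h (fderiv ℝ h x) (AffineMap.lineMap x y (0:ℝ)) := by
      simpa using (hd x).hasFDerivAt
    exact a.comp_hasDerivAt (0:ℝ) (AffineMap.hasDerivAt_lineMap)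
  have := h1.le_slope_of_hasDerivAt (Set.mem_univ 0) (Set.mem_univ 1) zero_lt_one h2
  simp [slope_def_field] at this
  rw [map_sub]
  linarith




/-- Per-step progress bound for AProx: for every integer `t ≥ 1`,
`⟪g^t, w^t − w^{t+1}⟫ + λΨ(w^t) − λΨ(w^{t+1}) ≤ η_t (G_f + λ G_Ψ)² / ρ`. -/
theorem aprox_per_step_progress
    {E : Type*} [NormedAddCommGroup E] [InnerProductSpace ℝ E] [FiniteDimensional ℝ E]
    (Ψ : E → ℝ) (GΨ : ℝ) (hGΨ : 0 ≤ GΨ)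
    (hΨconv : ConvexOn ℝ Set.univ Ψ)
    (hΨlip : ∀ x y : E, |Ψ x - Ψ y| ≤ GΨ * ‖x - y‖)
    (lam : ℝ) (hlam : 0 ≤ lam)
    (Gf : ℝ) (hGf : 0 ≤ Gf)
    (ρ : ℝ) (hρ : 0 < ρ)
    (h : E → ℝ) (hhdiff : Differentiable ℝ h)
    (hhsc : StrongConvexOn Set.univ ρ h)
    (Dh : E → E → ℝ)
    (hDh : ∀ u v : E, Dh u v = h u - h v - fderiv ℝ h v (u - v))
    (f : ℕ → E → ℝ)
    (hfconv : ∀ t, 1 ≤ t → ConvexOn ℝ Set.univ (f t))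
    (hflip : ∀ t, 1 ≤ t → ∀ x y : E, |f t x - f t y| ≤ Gf * ‖x - y‖)
    (η : ℕ → ℝ) (hη : ∀ t, 1 ≤ t → 0 < η t)
    (w g : ℕ → E)
    (hw1 : w 1 = w 0)
    (hsub : ∀ s, 1 ≤ s → ∀ y : E, f s (w s) + ⟪g s, y - w s⟫ ≤ f s y)
    (hgnorm : ∀ s, 1 ≤ s → ‖g s‖ ≤ Gf)
    (hiter : ∀ t, 1 ≤ t → ∀ y : E,
      (∑ s ∈ Finset.Icc 1 t, η s * (⟪g s, w (t + 1)⟫ + lam * Ψ (w (t + 1))))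
          + Dh (w (t + 1)) (w 0)
        ≤ (∑ s ∈ Finset.Icc 1 t, η s * (⟪g s, y⟫ + lam * Ψ y)) + Dh y (w 0)) :
    ∀ t : ℕ, 1 ≤ t →
      ⟪g t, w t - w (t + 1)⟫ + lam * Ψ (w t) - lam * Ψ (w (t + 1))
        ≤ η t * (Gf + lam * GΨ) ^ 2 / ρ := by
  have hobj : ∀ t : ℕ, StrongConvexOn Set.univ ρ
      (fun y => (∑ s ∈ Finset.Icc 1 t, η s * (⟪g s, y⟫ + lam * Ψ y)) + Dh y (w 0)) := by
    intro t
    have hlin : ∀ s, ConvexOn ℝ Set.univ (fun y : E => ⟪g s, y⟫) := fun s =>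
      ((innerSL ℝ (g s)).toLinearMap).convexOn convex_univ
    have hS : ConvexOn ℝ Set.univ
        (fun y => ∑ s ∈ Finset.Icc 1 t, η s * (⟪g s, y⟫ + lam * Ψ y)) := by
      refine ⟨convex_univ, fun x _ y _ a b ha hb hab => ?_⟩
      simp only [smul_eq_mul]
      rw [Finset.mul_sum, Finset.mul_sum, ← Finset.sum_add_distrib]
      refine Finset.sum_le_sum fun s hs => ?_
      have h1 := (hΨconv.2 (Set.mem_univ x) (Set.mem_univ y) ha hb hab)
      simp only [smul_eq_mul] at h1
      have h2 := mul_le_mul_of_nonneg_left h1 hlam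
      have h3 : ⟪g s, a • x + b • y⟫ + lam * Ψ (a • x + b • y)
          ≤ a * (⟪g s, x⟫ + lam * Ψ x) + b * (⟪g s, y⟫ + lam * Ψ y) := by
        rw [inner_add_right, inner_smul_right, inner_smul_right]
        linarith
      have h4 := mul_le_mul_of_nonneg_left h3 (hη s (Finset.mem_Icc.1 hs).1).le
      linarith
    refine ⟨convex_univ, fun x _ y _ a b ha hb hab => ?_⟩
    have h1 := hS.2 (Set.mem_univ x) (Set.mem_univ y) ha hb hab
    have h2 := hhsc.2 (Set.mem_univ x) (Set.mem_univ y) ha hb hab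
    simp only [smul_eq_mul] at h1 h2 ⊢
    simp only [hDh, map_sub, map_add, map_smul, smul_eq_mul]
    have hb' : b = 1 - a := by linarith
    subst hb'
    nlinarith
  have hmin : ∀ t : ℕ, ∀ y : E,
      (∑ s ∈ Finset.Icc 1 t, η s * (⟪g s, w (t + 1)⟫ + lam * Ψ (w (t + 1))))
          + Dh (w (t + 1)) (w 0)
        ≤ (∑ s ∈ Finset.Icc 1 t, η s * (⟪g s, y⟫ + lam * Ψ y)) + Dh y (w 0) := by
    intro t y
    rcases Nat.eq_zero_or_pos t with rfl | ht
    · have hc : ConvexOn ℝ Set.univ h := strongConvexOn_zero.1 (hhsc.mono hρ.le)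
      have := tangent_le h hhdiff hc (w 0) y
      simp only [hDh, zero_add, hw1]
      simp at this ⊢
      linarith
    · exact hiter t ht y
  intro t ht
  obtain ⟨n, rfl⟩ : ∃ n, t = n + 1 := ⟨t - 1, by omega⟩
  have A := quad_growth _ ρ (hobj n) _ (hmin n) (w (n + 1 + 1))
  have B := quad_growth _ ρ (hobj (n + 1)) _ (hmin (n + 1)) (w (n + 1))
  simp only [Finset.sum_Icc_succ_top (Nat.le_add_left 1 n)] at A B
  rw [norm_sub_rev] at B
  have hη' := hη (n + 1) ht
  have hL : ⟪g (n + 1), w (n + 1) - w (n + 1 + 1)⟫ + lam * Ψ (w (n + 1)) - lam * Ψ (w (n + 1 + 1))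
      ≤ (Gf + lam * GΨ) * ‖w (n + 1) - w (n + 1 + 1)‖ := by
    have h1 := real_inner_le_norm (g (n + 1)) (w (n + 1) - w (n + 1 + 1))
    have h2 := mul_le_mul_of_nonneg_right (hgnorm (n + 1) ht) (norm_nonneg (w (n + 1) - w (n + 1 + 1)))
    have h3 := mul_le_mul_of_nonneg_left
      ((le_abs_self _).trans (hΨlip (w (n + 1)) (w (n + 1 + 1)))) hlam
    linarith
  have hC : ρ * ‖w (n + 1) - w (n + 1 + 1)‖ ^ 2 ≤ η (n + 1) *
      (⟪g (n + 1), w (n + 1) - w (n + 1 + 1)⟫ + lam * Ψ (w (n + 1)) - lam * Ψ (w (n + 1 + 1))) := by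
    rw [inner_sub_right]
    linarith
  have hG : 0 ≤ Gf + lam * GΨ := by positivity
  have hd := norm_nonneg (w (n + 1) - w (n + 1 + 1))
  generalize ‖w (n + 1) - w (n + 1 + 1)‖ = d at *
  generalize ⟪g (n + 1), w (n + 1) - w (n + 1 + 1)⟫ + lam * Ψ (w (n + 1))
    - lam * Ψ (w (n + 1 + 1)) = X at *
  generalize Gf + lam * GΨ = G at *
  have hdle : ρ * d ≤ η (n + 1) * G := by
    rcases hd.eq_or_lt with h0 | h0
    · rw [← h0]; simp; positivity
    · have := mul_le_mul_of_nonneg_left hL hη'.le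
      refine le_of_mul_le_mul_left (a := d) ?_ h0
      nlinarith
  rw [le_div_iff₀ hρ]
  nlinarith [mul_le_mul_of_nonneg_left hdle hG, mul_le_mul_of_nonneg_right hL hρ.le]
end

section
/- Last-iterate conversion lemma (Lemma 1 of the paper): let T ≥ 1 be an integer, let η_1 ≥ η_2 ≥ ⋯ ≥ η_T > 0 be a non-increasing positive sequence of reals, and let q_1, …, q_T be nonnegative reals. Then η_T q_T ≤ (1/T) Σ_{t=1}^T η_t q_t + Σ_{k=1}^{T−1} (1/(k(k+1))) Σ_{t=T−k+1}^T η_t (q_t − q_{T−k}). -/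
/-- Last-iterate conversion lemma (Lemma 1 of the paper): let `T ≥ 1`,
let `η_1 ≥ η_2 ≥ ⋯ ≥ η_T > 0` be a non-increasing positive sequence, and let
`q_1, …, q_T` be nonnegative reals. Then
`η_T q_T ≤ (1/T) Σ_{t=1}^T η_t q_t
  + Σ_{k=1}^{T−1} (1/(k(k+1))) Σ_{t=T−k+1}^T η_t (q_t − q_{T−k})`. -/
theorem last_iterate_conversion
    (T : ℕ) (hT : 1 ≤ T)
    (η q : ℕ → ℝ)
    (hmono : ∀ s t : ℕ, 1 ≤ s → s ≤ t → t ≤ T → η t ≤ η s)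
    (hpos : ∀ t : ℕ, 1 ≤ t → t ≤ T → 0 < η t)
    (hq : ∀ t : ℕ, 1 ≤ t → t ≤ T → 0 ≤ q t) :
    η T * q T ≤ (1 / (T : ℝ)) * ∑ t ∈ Finset.Icc 1 T, η t * q t
      + ∑ k ∈ Finset.Icc 1 (T - 1), (1 / ((k : ℝ) * ((k : ℝ) + 1))) *
          ∑ t ∈ Finset.Icc (T - k + 1) T, η t * (q t - q (T - k)) := by
  have key : ∀ n : ℕ, n + 1 ≤ T → η T * q T ≤
      (1 / ((n : ℝ) + 1)) * ∑ t ∈ Finset.Icc (T - n) T, η t * q t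
      + ∑ k ∈ Finset.Icc 1 n, (1 / ((k : ℝ) * ((k : ℝ) + 1))) *
          ∑ t ∈ Finset.Icc (T - k + 1) T, η t * (q t - q (T - k)) := by
    intro n
    induction n with
    | zero => intro _; simp
    | succ n ih =>
      intro hn
      refine (ih (by omega)).trans ?_
      rw [Finset.sum_Icc_succ_top (by omega : 1 ≤ n + 1)]
      have e : T - (n + 1) + 1 = T - n := by omega
      have h1 : ∑ t ∈ Finset.Icc (T - (n + 1)) T, η t * q t
          = η (T - (n+1)) * q (T - (n+1)) + ∑ t ∈ Finset.Icc (T - n) T, η t * q t := by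
        rw [← e, ← Finset.add_sum_Ioc_eq_sum_Icc (by omega)]
        congr 2
        ext x
        simp only [Finset.mem_Ioc, Finset.mem_Icc]
        omega
      rw [h1, e]
      set m := T - (n + 1) with hm
      have h2 : ∑ t ∈ Finset.Icc (T - n) T, η t * (q t - q m)
          = ∑ t ∈ Finset.Icc (T - n) T, η t * q t
            - (∑ t ∈ Finset.Icc (T - n) T, η t) * q m := by
        rw [Finset.sum_mul, ← Finset.sum_sub_distrib]
        exact Finset.sum_congr rfl fun t _ => by ring
      have h3 : ∑ t ∈ Finset.Icc (T - n) T, η t ≤ ((n : ℝ) + 1) * η m := by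
        have := Finset.sum_le_card_nsmul (Finset.Icc (T - n) T) η (η m) (fun t ht => by
          rw [Finset.mem_Icc] at ht
          exact hmono m t (by omega) (by omega) ht.2)
        rw [Nat.card_Icc, show T + 1 - (T - n) = n + 1 by omega, nsmul_eq_mul] at this
        exact_mod_cast this
      have h4 := mul_le_mul_of_nonneg_right h3 (hq m (by omega) (by omega))
      rw [h2]
      generalize ∑ t ∈ Finset.Icc (T - n) T, η t * q t = A at *
      generalize (∑ t ∈ Finset.Icc (T - n) T, η t) * q m = B at *
      push_cast
      have hp : (0 : ℝ) < (n : ℝ) + 1 := by positivity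
      have hp2 : (0 : ℝ) < (n : ℝ) + 1 + 1 := by positivity
      have h5 : (1 / ((n : ℝ) + 1 + 1)) * (η m * q m + A)
          + 1 / (((n : ℝ) + 1) * ((n : ℝ) + 1 + 1)) * (A - B) - 1 / ((n : ℝ) + 1) * A
          = (((n : ℝ) + 1) * η m * q m - B) / (((n : ℝ) + 1) * ((n : ℝ) + 1 + 1)) := by
        field_simp
        ring
      have h6 : 0 ≤ (((n : ℝ) + 1) * η m * q m - B) / (((n : ℝ) + 1) * ((n : ℝ) + 1 + 1)) :=
        div_nonneg (by linarith) (by positivity)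
      linarith
  have h := key (T - 1) (by omega)
  rw [show T - (T - 1) = 1 by omega, Nat.cast_sub hT] at h
  simpa using h
end

section
/- Harmonic double-sum bound: for every integer T ≥ 2, Σ_{k=1}^{T−1} (1/(k(k+1))) Σ_{t=T−k}^T (1/t) ≤ 2(1 + ln T)/T. -/
lemma aux_S (j m : ℕ) : ∑ t ∈ Finset.Icc (j+1) (j+1+m), (1 / (t : ℝ))
    = (harmonic (j+1+m) : ℝ) - (harmonic j : ℝ) := by
  induction m with
  | zero => simp [harmonic_succ]
  | succ m ih =>
    rw [← add_assoc, Finset.sum_Icc_succ_top (by omega), ih, harmonic_succ (j+1+m)]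
    push_cast
    ring

lemma aux_main (T m : ℕ) : ∀ j : ℕ, T = m + 1 + j →
    ∑ k ∈ Finset.Icc 1 m, (1 / ((k : ℝ) * ((k : ℝ) + 1))) *
        ∑ t ∈ Finset.Icc (T - k) T, (1 / (t : ℝ))
      = ((harmonic m : ℝ) + (harmonic (T-1) : ℝ) - (harmonic j : ℝ)) / T + 1 / T
        - ((harmonic T : ℝ) - (harmonic j : ℝ)) / (m + 1) := by
  induction m with
  | zero =>
    intro j hj
    have h1 : T = j + 1 := by omega
    subst h1
    simp [harmonic_succ]
  | succ m ih =>
    intro j hj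
    rw [Finset.sum_Icc_succ_top (by omega), ih (j+1) (by omega)]
    have h1 : T - (m+1) = j + 1 := by omega
    have h2 : Finset.Icc (T - (m+1)) T = Finset.Icc (j+1) (j+1+(m+1)) := by
      rw [h1]; congr 1; omega
    have h3 : j + 1 + (m+1) = T := by omega
    rw [h2, aux_S, h3, harmonic_succ m, harmonic_succ j]
    have hT : (T : ℝ) = m + 1 + 1 + j := by rw [hj]; push_cast; ring
    push_cast
    rw [hT]
    have a1 : (m : ℝ) + 1 ≠ 0 := by positivity
    have a2 : (m : ℝ) + 1 + 1 ≠ 0 := by positivity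
    have a3 : (j : ℝ) + 1 ≠ 0 := by positivity
    have a4 : (m : ℝ) + 1 + 1 + j ≠ 0 := by positivity
    field_simp
    ring

/-- Harmonic double-sum bound: for every integer `T ≥ 2`,
`Σ_{k=1}^{T−1} (1/(k(k+1))) Σ_{t=T−k}^T (1/t) ≤ 2(1 + ln T)/T`. -/
theorem harmonic_double_sum_bound
    (T : ℕ) (hT : 2 ≤ T) :
    ∑ k ∈ Finset.Icc 1 (T - 1), (1 / ((k : ℝ) * ((k : ℝ) + 1))) *
        ∑ t ∈ Finset.Icc (T - k) T, (1 / (t : ℝ))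
      ≤ 2 * (1 + Real.log T) / T := by
  rw [aux_main T (T-1) 0 (by omega)]
  obtain ⟨n, rfl⟩ : ∃ n, T = n + 1 := ⟨T - 1, by omega⟩
  have h := harmonic_le_one_add_log (n+1)
  have hl : 0 ≤ Real.log ((n+1 : ℕ) : ℝ) := Real.log_natCast_nonneg _
  have hs : (harmonic (n+1) : ℝ) = harmonic n + ((n : ℝ)+1)⁻¹ := by
    rw [harmonic_succ]; push_cast; ring
  have hp : 0 ≤ ((n : ℝ)+1)⁻¹ := by positivity
  simp only [Nat.add_sub_cancel, harmonic_zero, Rat.cast_zero, sub_zero]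
  have e : ((n+1 : ℕ) : ℝ) = n + 1 := by push_cast; ring
  rw [e] at h hl ⊢
  rw [← add_div, ← sub_div]
  gcongr
  linarith
end

section
/- Average-iterate convergence of AProx with diminishing step sizes (Theorem 1(b) of the paper, exact-gradient form): assume G > 0 and R := ‖w^0 − w*‖ > 0, take h(w) = (1/2)‖w‖² (so D_h(u, w) = (1/2)‖u − w‖² and ρ = 1), and use the step sizes η_s = (R/(2G))·(1/√s). Then for every integer t ≥ 1, the weighted average w̄^t := (Σ_{s=1}^t η_s)^{-1} Σ_{s=1}^t η_s w^s satisfies F_λ(w̄^t) − F_λ(w*) ≤ G R (2 + 1.5 ln t)/√t. -/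
open RealInnerProductSpace

theorem quad_growth_aux {E : Type*} [NormedAddCommGroup E] [InnerProductSpace ℝ E]
    (c : E → ℝ) (hc : ConvexOn ℝ Set.univ c) (w0 v : E)
    (hmin : ∀ y, c v + (1 / 2) * ‖v - w0‖ ^ 2 ≤ c y + (1 / 2) * ‖y - w0‖ ^ 2) (y : E) :
    c v + (1 / 2) * ‖v - w0‖ ^ 2 + (1 / 2) * ‖y - v‖ ^ 2 ≤ c y + (1 / 2) * ‖y - w0‖ ^ 2 := by
  have key : ∀ θ : ℝ, 0 < θ → θ < 1 →
      c v + (1 / 2) * ‖v - w0‖ ^ 2 + (1 - θ) * ((1 / 2) * ‖y - v‖ ^ 2)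
        ≤ c y + (1 / 2) * ‖y - w0‖ ^ 2 := by
    intro θ h0 h1
    have h2 := hc.2 (Set.mem_univ v) (Set.mem_univ y) (by linarith : 0 ≤ 1 - θ) h0.le (by ring)
    have h3 := hmin ((1 - θ) • v + θ • y)
    have e1 : (1 - θ) • v + θ • y - w0 = (1 - θ) • (v - w0) + θ • (y - w0) := by module
    have e2 : y - v = (y - w0) - (v - w0) := by abel
    have h4 : ‖(1 - θ) • v + θ • y - w0‖ ^ 2 = (1 - θ) * ‖v - w0‖ ^ 2 + θ * ‖y - w0‖ ^ 2
        - θ * (1 - θ) * ‖y - v‖ ^ 2 := by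
      rw [e1, e2]
      generalize v - w0 = a
      generalize y - w0 = b
      rw [norm_add_sq_real, norm_sub_sq_real, norm_smul, norm_smul, inner_smul_left,
        inner_smul_right, mul_pow, mul_pow, Real.norm_eq_abs, Real.norm_eq_abs, sq_abs, sq_abs,
        real_inner_comm a b]
      simp only [conj_trivial]
      ring
    rw [h4] at h3
    simp only [smul_eq_mul] at h2
    have h5 : θ * (c v + (1 / 2) * ‖v - w0‖ ^ 2 + (1 - θ) * ((1 / 2) * ‖y - v‖ ^ 2))
        ≤ θ * (c y + (1 / 2) * ‖y - w0‖ ^ 2) := by nlinarith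
    exact le_of_mul_le_mul_left h5 h0
  by_contra hcon
  push Not at hcon
  set A := c v + (1 / 2) * ‖v - w0‖ ^ 2
  set B := c y + (1 / 2) * ‖y - w0‖ ^ 2
  set D := (1 / 2) * ‖y - v‖ ^ 2 with hD
  have hAB : A ≤ B := hmin y
  have hDp : 0 < D := by linarith
  have := key ((A + D - B) / (2 * D)) (by apply div_pos <;> linarith)
    (by rw [div_lt_one] <;> linarith)
  have h6 : (A + D - B) / (2 * D) * D = (A + D - B) / 2 := by field_simp
  nlinarith

theorem harm_aux (t : ℕ) (ht : 1 ≤ t) :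
    ∑ s ∈ Finset.Icc 1 t, (1 / (s : ℝ)) ≤ 1 + Real.log t := by
  have h := harmonic_le_one_add_log t
  rw [harmonic_eq_sum_Icc] at h
  push_cast at h
  simpa using h

/-- Average-iterate convergence of AProx with diminishing step sizes
(Theorem 1(b), exact-gradient form): with `G > 0`, `R := ‖w^0 − w*‖ > 0`,
`h(w) = (1/2)‖w‖²` (so `D_h(u,w) = (1/2)‖u − w‖²`, `ρ = 1`) and step sizes
`η_s = (R/(2G))·(1/√s)`, for every `t ≥ 1` the weighted average
`w̄^t := (Σ η_s)⁻¹ Σ η_s w^s` satisfies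
`F_λ(w̄^t) − F_λ(w*) ≤ G R (2 + 1.5 ln t)/√t`. -/
theorem aprox_average_iterate_diminishing
    {E : Type*} [NormedAddCommGroup E] [InnerProductSpace ℝ E] [FiniteDimensional ℝ E]
    (Ψ : E → ℝ) (GΨ : ℝ) (hGΨ : 0 ≤ GΨ)
    (hΨconv : ConvexOn ℝ Set.univ Ψ)
    (hΨlip : ∀ x y : E, |Ψ x - Ψ y| ≤ GΨ * ‖x - y‖)
    (lam : ℝ) (hlam : 0 ≤ lam)
    (Gf : ℝ) (hGf : 0 ≤ Gf)
    (f : E → ℝ)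
    (hfconv : ConvexOn ℝ Set.univ f)
    (hflip : ∀ x y : E, |f x - f y| ≤ Gf * ‖x - y‖)
    (G : ℝ) (hG : G = Gf + lam * GΨ) (hGpos : 0 < G)
    (wstar : E)
    (hstar : ∀ y : E, f wstar + lam * Ψ wstar ≤ f y + lam * Ψ y)
    (w g : ℕ → E)
    (R : ℝ) (hR : R = ‖w 0 - wstar‖) (hRpos : 0 < R)
    (η : ℕ → ℝ)
    (hη : ∀ s : ℕ, 1 ≤ s → η s = (R / (2 * G)) * (1 / Real.sqrt s))
    (hw1 : w 1 = w 0)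
    (hsub : ∀ s, 1 ≤ s → ∀ y : E, f (w s) + ⟪g s, y - w s⟫ ≤ f y)
    (hgnorm : ∀ s, 1 ≤ s → ‖g s‖ ≤ Gf)
    (hiter : ∀ t, 1 ≤ t → ∀ y : E,
      (∑ s ∈ Finset.Icc 1 t, η s * (⟪g s, w (t + 1)⟫ + lam * Ψ (w (t + 1))))
          + (1 / 2) * ‖w (t + 1) - w 0‖ ^ 2
        ≤ (∑ s ∈ Finset.Icc 1 t, η s * (⟪g s, y⟫ + lam * Ψ y))
          + (1 / 2) * ‖y - w 0‖ ^ 2) :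
    ∀ t : ℕ, 1 ≤ t → ∀ wbar : E,
      wbar = (∑ s ∈ Finset.Icc 1 t, η s)⁻¹ • ∑ s ∈ Finset.Icc 1 t, η s • w s →
      (f wbar + lam * Ψ wbar) - (f wstar + lam * Ψ wstar)
        ≤ G * R * (2 + 1.5 * Real.log t) / Real.sqrt t := by
  have hηpos : ∀ s, 1 ≤ s → 0 < η s := by
    intro s hs
    rw [hη s hs]
    have : (0 : ℝ) < s := by exact_mod_cast hs
    positivity
  have hconv : ∀ n : ℕ, ConvexOn ℝ Set.univ
      (fun y => ∑ s ∈ Finset.Icc 1 n, η s * (⟪g s, y⟫ + lam * Ψ y)) := by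
    intro n
    refine ⟨convex_univ, ?_⟩
    intro x _ y _ a b ha hb hab
    simp only [smul_eq_mul, Finset.mul_sum]
    rw [← Finset.sum_add_distrib]
    apply Finset.sum_le_sum
    intro s hs
    have h1 := hηpos s (Finset.mem_Icc.1 hs).1
    have h2 := hΨconv.2 (Set.mem_univ x) (Set.mem_univ y) ha hb hab
    simp only [smul_eq_mul] at h2
    rw [inner_add_right, inner_smul_right, inner_smul_right]
    have h3 := mul_le_mul_of_nonneg_left (mul_le_mul_of_nonneg_left h2 hlam) h1.le
    nlinarith
  have hmin : ∀ n : ℕ, ∀ y : E,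
      (∑ s ∈ Finset.Icc 1 n, η s * (⟪g s, w (n + 1)⟫ + lam * Ψ (w (n + 1))))
          + (1 / 2) * ‖w (n + 1) - w 0‖ ^ 2
        ≤ (∑ s ∈ Finset.Icc 1 n, η s * (⟪g s, y⟫ + lam * Ψ y))
          + (1 / 2) * ‖y - w 0‖ ^ 2 := by
    intro n y
    rcases Nat.eq_zero_or_pos n with h | h
    · subst h
      simp [hw1]
    · exact hiter n h y
  have hreg : ∀ n : ℕ, ∑ s ∈ Finset.Icc 1 n, η s * (⟪g s, w s⟫ + lam * Ψ (w s)) ≤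
      (∑ s ∈ Finset.Icc 1 n, η s * (⟪g s, w (n + 1)⟫ + lam * Ψ (w (n + 1))))
          + (1 / 2) * ‖w (n + 1) - w 0‖ ^ 2
        + ∑ s ∈ Finset.Icc 1 n, (η s) ^ 2 * G ^ 2 / 2 := by
    intro n
    induction n with
    | zero => simp [hw1]
    | succ n ih =>
      rw [Finset.sum_Icc_succ_top (by omega), Finset.sum_Icc_succ_top (by omega),
        Finset.sum_Icc_succ_top (by omega)]
      have hq := quad_growth_aux _ (hconv n) (w 0) (w (n + 1)) (hmin n) (w (n + 1 + 1))
      have hp := hηpos (n + 1) (by omega)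
      set d := ‖w (n + 1 + 1) - w (n + 1)‖ with hd
      have h1 : ⟪g (n + 1), w (n + 1)⟫ - ⟪g (n + 1), w (n + 1 + 1)⟫ ≤ Gf * d := by
        rw [← inner_sub_right]
        refine (real_inner_le_norm _ _).trans ?_
        rw [norm_sub_rev, ← hd]
        exact mul_le_mul_of_nonneg_right (hgnorm _ (by omega)) (norm_nonneg _)
      have h2 : Ψ (w (n + 1)) - Ψ (w (n + 1 + 1)) ≤ GΨ * d := by
        have := (abs_le.1 (hΨlip (w (n + 1)) (w (n + 1 + 1)))).2
        rwa [norm_sub_rev, ← hd] at this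
      have h3 := mul_le_mul_of_nonneg_left h2 hlam
      have h4 : (⟪g (n + 1), w (n + 1)⟫ + lam * Ψ (w (n + 1)))
          - (⟪g (n + 1), w (n + 1 + 1)⟫ + lam * Ψ (w (n + 1 + 1))) ≤ G * d := by
        rw [hG]; linarith
      have h5 := mul_le_mul_of_nonneg_left h4 hp.le
      have h6 : η (n + 1) * (G * d) ≤ (1 / 2) * d ^ 2 + (η (n + 1)) ^ 2 * G ^ 2 / 2 := by
        nlinarith [sq_nonneg (d - η (n + 1) * G)]
      linarith
  intro t ht wbar hwbar
  have htR : (0 : ℝ) < t := by exact_mod_cast ht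
  have hst : 0 < Real.sqrt t := Real.sqrt_pos.2 htR
  have hlog : 0 ≤ Real.log t := Real.log_nonneg (by exact_mod_cast ht)
  set S := ∑ s ∈ Finset.Icc 1 t, η s with hS
  have hSge : R / (2 * G) * Real.sqrt t ≤ S := by
    have h1 : ∑ s ∈ Finset.Icc 1 t, (R / (2 * G) * (1 / Real.sqrt t)) ≤ S := by
      apply Finset.sum_le_sum
      intro s hs
      obtain ⟨hs1, hs2⟩ := Finset.mem_Icc.1 hs
      have : (0 : ℝ) < s := by exact_mod_cast hs1
      have h' : (s : ℝ) ≤ t := by exact_mod_cast hs2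
      rw [hη s hs1]
      have := Real.sqrt_pos.2 this
      gcongr
    have h2 : ∑ s ∈ Finset.Icc 1 t, (R / (2 * G) * (1 / Real.sqrt t))
        = R / (2 * G) * Real.sqrt t := by
      rw [Finset.sum_const, Nat.card_Icc, nsmul_eq_mul]
      rw [show t + 1 - 1 = t by omega]
      have h3 : (t : ℝ) = Real.sqrt t * Real.sqrt t := (Real.mul_self_sqrt htR.le).symm
      field_simp
      rw [Real.sq_sqrt htR.le]
    linarith
  have hSpos : 0 < S := lt_of_lt_of_le (by positivity) hSge
  have hsq : ∑ s ∈ Finset.Icc 1 t, (η s) ^ 2 * G ^ 2 / 2 ≤ R ^ 2 / 8 * (1 + Real.log t) := by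
    have h1 : ∑ s ∈ Finset.Icc 1 t, (η s) ^ 2 * G ^ 2 / 2
        = R ^ 2 / 8 * ∑ s ∈ Finset.Icc 1 t, (1 / (s : ℝ)) := by
      rw [Finset.mul_sum]
      apply Finset.sum_congr rfl
      intro s hs
      have hs1 := (Finset.mem_Icc.1 hs).1
      have hs0 : (0 : ℝ) < s := by exact_mod_cast hs1
      rw [hη s hs1, mul_pow, div_pow, div_pow, Real.sq_sqrt hs0.le]
      field_simp
      norm_num
    rw [h1]
    exact mul_le_mul_of_nonneg_left (harm_aux t ht) (by positivity)
  have hF : ConvexOn ℝ Set.univ (fun y => f y + lam * Ψ y) := by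
    have := hfconv.add (hΨconv.smul hlam)
    exact this
  have hjen : S * (f wbar + lam * Ψ wbar) ≤
      ∑ s ∈ Finset.Icc 1 t, η s * (f (w s) + lam * Ψ (w s)) := by
    have h := hF.map_centerMass_le (t := Finset.Icc 1 t) (w := η) (p := w)
      (fun s hs => (hηpos s (Finset.mem_Icc.1 hs).1).le) hSpos (fun _ _ => Set.mem_univ _)
    simp only [Finset.centerMass, ← hS, ← hwbar, smul_eq_mul, Function.comp] at h
    have := mul_le_mul_of_nonneg_left h hSpos.le
    rwa [← mul_assoc, mul_inv_cancel₀ hSpos.ne', one_mul] at this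
  have hlin : ∑ s ∈ Finset.Icc 1 t, η s * (f (w s) + lam * Ψ (w s))
      - S * (f wstar + lam * Ψ wstar) ≤
      ∑ s ∈ Finset.Icc 1 t, η s * (⟪g s, w s⟫ + lam * Ψ (w s))
      - ∑ s ∈ Finset.Icc 1 t, η s * (⟪g s, wstar⟫ + lam * Ψ wstar) := by
    rw [hS, Finset.sum_mul, ← Finset.sum_sub_distrib, ← Finset.sum_sub_distrib]
    apply Finset.sum_le_sum
    intro s hs
    have hs1 := (Finset.mem_Icc.1 hs).1
    have h1 := hsub s hs1 wstar
    rw [inner_sub_right] at h1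
    rw [← mul_sub, ← mul_sub]
    apply mul_le_mul_of_nonneg_left _ (hηpos s hs1).le
    linarith
  have h1 := hreg t
  have h2 := hmin t wstar
  rw [norm_sub_rev wstar, ← hR] at h2
  set Δ := (f wbar + lam * Ψ wbar) - (f wstar + lam * Ψ wstar) with hΔ
  have hΔ0 : 0 ≤ Δ := by have := hstar wbar; linarith
  have h3 : S * Δ ≤ R ^ 2 / 2 + R ^ 2 / 8 * (1 + Real.log t) := by
    rw [hΔ, mul_sub]; linarith
  have h4 : R / (2 * G) * Real.sqrt t * Δ ≤ R ^ 2 / 2 + R ^ 2 / 8 * (1 + Real.log t) :=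
    (mul_le_mul_of_nonneg_right hSge hΔ0).trans h3
  rw [le_div_iff₀ hst]
  have h5 : Δ * Real.sqrt t = (2 * G / R) * (R / (2 * G) * Real.sqrt t * Δ) := by
    field_simp
  rw [h5]
  refine (mul_le_mul_of_nonneg_left h4 (by positivity)).trans ?_
  have h6 : 2 * G / R * (R ^ 2 / 2 + R ^ 2 / 8 * (1 + Real.log t))
      = G * R * (5 / 4 + 1 / 4 * Real.log t) := by
    field_simp
    ring
  rw [h6]
  apply mul_le_mul_of_nonneg_left _ (by positivity)
  norm_num
  linarith
end

section
/- Average-iterate convergence of AProx with an optimal constant step size: assume G > 0, let R > 0 satisfy D_h(w*, w^0) ≤ R², fix an integer T ≥ 1, and use the constant step sizes η_s = (R/G)·√(ρ/T) for s = 1, …, T. Then the weighted average w̄^T := (1/T) Σ_{s=1}^T w^s satisfies F_λ(w̄^T) − F_λ(w*) ≤ 2 G R / √(ρ T). -/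
open RealInnerProductSpace

lemma growth_aux {E : Type*} [NormedAddCommGroup E] [InnerProductSpace ℝ E]
    (φ : E → ℝ) (ρ : ℝ) (hφ : StrongConvexOn Set.univ ρ φ) (x : E)
    (hx : ∀ y, φ x ≤ φ y) (y : E) : φ x + ρ / 2 * ‖x - y‖ ^ 2 ≤ φ y := by
  by_contra hc
  push Not at hc
  have hxy := hx y
  set c := ρ / 2 * ‖x - y‖ ^ 2 with hcdef
  set K := φ y - φ x with hK
  have hcpos : 0 < c := by linarith
  have ha : 0 < (c - K) / (2 * c) := div_pos (by linarith) (by linarith)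
  have ha1 : (c - K) / (2 * c) ≤ 1 := by
    rw [div_le_one (by linarith)]; linarith
  set a := (c - K) / (2 * c) with hadef
  have hac : a * c = (c - K) / 2 := by rw [hadef]; field_simp
  have h1 := hφ.2 (Set.mem_univ x) (Set.mem_univ y) (sub_nonneg.2 ha1) ha.le (by ring)
  have h2 := hx ((1 - a) • x + a • y)
  simp only [smul_eq_mul] at h1
  rw [← hcdef] at h1
  have h3 : a * (K - (1 - a) * c) ≥ 0 := by
    rw [hK]; linarith
  have h4 : 0 ≤ K - (1 - a) * c := nonneg_of_mul_nonneg_right h3 ha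
  linarith

lemma bregman_aux {E : Type*} [NormedAddCommGroup E] [InnerProductSpace ℝ E]
    (h : E → ℝ) (hd : Differentiable ℝ h) (hc : ConvexOn ℝ Set.univ h) (x y : E) :
    0 ≤ h y - h x - fderiv ℝ h x (y - x) := by
  have h1 : ConvexOn ℝ Set.univ (fun t : ℝ => h (AffineMap.lineMap x y t)) := by
    simpa using! hc.comp_affineMap (AffineMap.lineMap x y : ℝ →ᵃ[ℝ] E)
  have h2 : HasDerivAt (fun t : ℝ => h (AffineMap.lineMap x y t)) (fderiv ℝ h x (y - x)) 0 := by
    have h3 : HasFDerivAt h (fderiv ℝ h x) (AffineMap.lineMap x y (0 : ℝ)) := by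
      simpa using (hd x).hasFDerivAt
    exact h3.comp_hasDerivAt (0 : ℝ) AffineMap.hasDerivAt_lineMap
  have h4 := h1.le_slope_of_hasDerivAt (Set.mem_univ 0) (Set.mem_univ 1) one_pos h2
  simp [slope_def_field] at h4
  simp
  linarith

lemma strong_aux {E : Type*} [NormedAddCommGroup E] [InnerProductSpace ℝ E]
    (Ψ : E → ℝ) (hΨ : ConvexOn ℝ Set.univ Ψ) (lam : ℝ) (hlam : 0 ≤ lam) (ρ : ℝ)
    (h : E → ℝ) (hs : StrongConvexOn Set.univ ρ h) (η : ℕ → ℝ) (hη : ∀ t, 1 ≤ t → 0 < η t)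
    (g : ℕ → E) (w0 : E) (L : E →L[ℝ] ℝ) (t : ℕ) :
    StrongConvexOn Set.univ ρ (fun y => (∑ s ∈ Finset.Icc 1 t, η s * (⟪g s, y⟫ + lam * Ψ y))
      + (h y - h w0 - L (y - w0))) := by
  refine ⟨convex_univ, fun x _ y _ a b ha hb hab => ?_⟩
  have h1 := hs.2 (Set.mem_univ x) (Set.mem_univ y) ha hb hab
  have h2 := hΨ.2 (Set.mem_univ x) (Set.mem_univ y) ha hb hab
  have h3 : ∑ s ∈ Finset.Icc 1 t, η s * (⟪g s, a • x + b • y⟫ + lam * Ψ (a • x + b • y)) ≤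
      a * ∑ s ∈ Finset.Icc 1 t, η s * (⟪g s, x⟫ + lam * Ψ x) +
      b * ∑ s ∈ Finset.Icc 1 t, η s * (⟪g s, y⟫ + lam * Ψ y) := by
    rw [Finset.mul_sum, Finset.mul_sum, ← Finset.sum_add_distrib]
    apply Finset.sum_le_sum
    intro s hs
    have h4 := hη s (Finset.mem_Icc.1 hs).1
    have h5 := mul_le_mul_of_nonneg_left (mul_le_mul_of_nonneg_left h2 hlam) h4.le
    rw [inner_add_right, inner_smul_right, inner_smul_right]
    simp only [smul_eq_mul] at h5
    linarith
  have hb' : b = 1 - a := by linarith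
  subst hb'
  simp only [smul_eq_mul, map_sub, map_add, map_smul] at h1 ⊢
  linarith

/-- Average-iterate convergence of AProx with an optimal constant step
size: assume `G > 0`, let `R > 0` satisfy `D_h(w*, w^0) ≤ R²`, fix `T ≥ 1`, and use
`η_s = (R/G)·√(ρ/T)` for `s = 1, …, T`. Then `w̄^T := (1/T) Σ_{s=1}^T w^s` satisfies
`F_λ(w̄^T) − F_λ(w*) ≤ 2 G R / √(ρ T)`. -/
theorem aprox_average_iterate_constant_step
    {E : Type*} [NormedAddCommGroup E] [InnerProductSpace ℝ E] [FiniteDimensional ℝ E]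
    (Ψ : E → ℝ) (GΨ : ℝ) (hGΨ : 0 ≤ GΨ)
    (hΨconv : ConvexOn ℝ Set.univ Ψ)
    (hΨlip : ∀ x y : E, |Ψ x - Ψ y| ≤ GΨ * ‖x - y‖)
    (lam : ℝ) (hlam : 0 ≤ lam)
    (Gf : ℝ) (hGf : 0 ≤ Gf)
    (ρ : ℝ) (hρ : 0 < ρ)
    (h : E → ℝ) (hhdiff : Differentiable ℝ h)
    (hhsc : StrongConvexOn Set.univ ρ h)
    (Dh : E → E → ℝ)
    (hDh : ∀ u v : E, Dh u v = h u - h v - fderiv ℝ h v (u - v))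
    (f : E → ℝ)
    (hfconv : ConvexOn ℝ Set.univ f)
    (hflip : ∀ x y : E, |f x - f y| ≤ Gf * ‖x - y‖)
    (G : ℝ) (hG : G = Gf + lam * GΨ) (hGpos : 0 < G)
    (wstar : E)
    (hstar : ∀ y : E, f wstar + lam * Ψ wstar ≤ f y + lam * Ψ y)
    (η : ℕ → ℝ) (hη : ∀ t, 1 ≤ t → 0 < η t)
    (w g : ℕ → E)
    (hw1 : w 1 = w 0)
    (hsub : ∀ s, 1 ≤ s → ∀ y : E, f (w s) + ⟪g s, y - w s⟫ ≤ f y)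
    (hgnorm : ∀ s, 1 ≤ s → ‖g s‖ ≤ Gf)
    (hiter : ∀ t, 1 ≤ t → ∀ y : E,
      (∑ s ∈ Finset.Icc 1 t, η s * (⟪g s, w (t + 1)⟫ + lam * Ψ (w (t + 1))))
          + Dh (w (t + 1)) (w 0)
        ≤ (∑ s ∈ Finset.Icc 1 t, η s * (⟪g s, y⟫ + lam * Ψ y)) + Dh y (w 0))
    (T : ℕ) (hT : 1 ≤ T)
    (R : ℝ) (hRpos : 0 < R) (hDR : Dh wstar (w 0) ≤ R ^ 2)
    (hηconst : ∀ s : ℕ, 1 ≤ s → s ≤ T → η s = (R / G) * Real.sqrt (ρ / T)) :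
    ∀ wbar : E, wbar = ((T : ℝ))⁻¹ • ∑ s ∈ Finset.Icc 1 T, w s →
      (f wbar + lam * Ψ wbar) - (f wstar + lam * Ψ wstar)
        ≤ 2 * G * R / Real.sqrt (ρ * T) := by
  intro wbar hwbar
  have hstrong := strong_aux Ψ hΨconv lam hlam ρ h hhsc η hη g (w 0) (fderiv ℝ h (w 0))
  have hconvh : ConvexOn ℝ Set.univ h := by
    apply UniformConvexOn.convexOn hhsc
    intro r
    simp only [Pi.zero_apply]
    positivity
  simp only [← hDh] at hstrong
  have hD0 : Dh (w 0) (w 0) = 0 := by rw [hDh]; simp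
  have hmin : ∀ t, ∀ y : E,
      (∑ s ∈ Finset.Icc 1 t, η s * (⟪g s, w (t + 1)⟫ + lam * Ψ (w (t + 1))))
          + Dh (w (t + 1)) (w 0)
        ≤ (∑ s ∈ Finset.Icc 1 t, η s * (⟪g s, y⟫ + lam * Ψ y)) + Dh y (w 0) := by
    intro t y
    rcases Nat.eq_zero_or_pos t with rfl | ht
    · have := bregman_aux h hhdiff hconvh (w 0) y
      rw [← hDh] at this
      simp [hw1, hD0, this]
    · exact hiter t ht y
  have key : ∀ t, ∑ s ∈ Finset.Icc 1 t, η s * (⟪g s, w s⟫ + lam * Ψ (w s)) ≤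
      ((∑ s ∈ Finset.Icc 1 t, η s * (⟪g s, w (t + 1)⟫ + lam * Ψ (w (t + 1))))
          + Dh (w (t + 1)) (w 0)) + ∑ s ∈ Finset.Icc 1 t, η s ^ 2 * G ^ 2 / (2 * ρ) := by
    intro t
    induction t with
    | zero => simp [hw1, hD0]
    | succ t ih =>
      have hg := growth_aux _ ρ (hstrong t) (w (t + 1)) (hmin t) (w (t + 1 + 1))
      rw [Finset.sum_Icc_succ_top (by omega), Finset.sum_Icc_succ_top (by omega),
        Finset.sum_Icc_succ_top (by omega)]
      have he := hη (t + 1) (by omega)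
      set d := ‖w (t + 1) - w (t + 1 + 1)‖ with hd
      have h1 : ⟪g (t + 1), w (t + 1)⟫ - ⟪g (t + 1), w (t + 1 + 1)⟫ ≤ Gf * d := by
        rw [← inner_sub_right]
        exact (real_inner_le_norm _ _).trans
          (mul_le_mul_of_nonneg_right (hgnorm _ (by omega)) (norm_nonneg _))
      have h2 : lam * (Ψ (w (t + 1)) - Ψ (w (t + 1 + 1))) ≤ lam * (GΨ * d) :=
        mul_le_mul_of_nonneg_left ((le_abs_self _).trans (hΨlip _ _)) hlam
      have h3 : η (t + 1) * ((⟪g (t + 1), w (t + 1)⟫ + lam * Ψ (w (t + 1))) -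
          (⟪g (t + 1), w (t + 1 + 1)⟫ + lam * Ψ (w (t + 1 + 1)))) ≤ η (t + 1) * (G * d) := by
        apply mul_le_mul_of_nonneg_left _ he.le
        rw [hG]; linarith
      have h4 : η (t + 1) * (G * d) ≤ ρ / 2 * d ^ 2 + η (t + 1) ^ 2 * G ^ 2 / (2 * ρ) := by
        have : ρ / 2 * d ^ 2 + η (t + 1) ^ 2 * G ^ 2 / (2 * ρ) - η (t + 1) * (G * d)
          = (ρ * d - η (t + 1) * G) ^ 2 / (2 * ρ) := by field_simp; ring
        have h5 : 0 ≤ (ρ * d - η (t + 1) * G) ^ 2 / (2 * ρ) := by positivity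
        linarith
      linarith
  have hTpos : (0 : ℝ) < T := by exact_mod_cast hT
  have hq : 0 < Real.sqrt (ρ * T) := Real.sqrt_pos.2 (by positivity)
  have hq2 : Real.sqrt (ρ * T) ^ 2 = ρ * T := Real.sq_sqrt (by positivity)
  have hsq : Real.sqrt (ρ / T) = Real.sqrt (ρ * T) / T := by
    rw [Real.sqrt_eq_iff_mul_self_eq (by positivity) (by positivity)]
    field_simp
    linarith
  set q := Real.sqrt (ρ * T) with hqdef
  rw [hsq] at hηconst
  set e := R / G * (q / T) with hedef
  have hepos : 0 < e := by positivity
  have hk := (key T).trans (add_le_add_left (hmin T wstar) _)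
  have hs2 : ∑ s ∈ Finset.Icc 1 T, η s ^ 2 * G ^ 2 / (2 * ρ) = R ^ 2 / 2 := by
    have : ∀ s ∈ Finset.Icc 1 T, η s ^ 2 * G ^ 2 / (2 * ρ) = e ^ 2 * G ^ 2 / (2 * ρ) := by
      intro s hs
      rw [hηconst s (Finset.mem_Icc.1 hs).1 (Finset.mem_Icc.1 hs).2]
    rw [Finset.sum_congr rfl this, Finset.sum_const, Nat.card_Icc, nsmul_eq_mul, hedef]
    simp only [Nat.add_sub_cancel]
    field_simp
    rw [hq2]; ring
  have hS : e * ∑ s ∈ Finset.Icc 1 T,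
      ((f (w s) + lam * Ψ (w s)) - (f wstar + lam * Ψ wstar)) ≤ 3 / 2 * R ^ 2 := by
    have : e * ∑ s ∈ Finset.Icc 1 T,
        ((f (w s) + lam * Ψ (w s)) - (f wstar + lam * Ψ wstar)) ≤
        ∑ s ∈ Finset.Icc 1 T, η s * (⟪g s, w s⟫ + lam * Ψ (w s)) -
        ∑ s ∈ Finset.Icc 1 T, η s * (⟪g s, wstar⟫ + lam * Ψ wstar) := by
      rw [Finset.mul_sum, ← Finset.sum_sub_distrib]
      apply Finset.sum_le_sum
      intro s hs
      rw [hηconst s (Finset.mem_Icc.1 hs).1 (Finset.mem_Icc.1 hs).2, ← mul_sub]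
      apply mul_le_mul_of_nonneg_left _ hepos.le
      have := hsub s (Finset.mem_Icc.1 hs).1 wstar
      rw [inner_sub_right] at this
      linarith
    linarith
  have hJ : ∀ k : E → ℝ, ConvexOn ℝ Set.univ k →
      k wbar ≤ (T : ℝ)⁻¹ * ∑ s ∈ Finset.Icc 1 T, k (w s) := by
    intro k hk
    have := hk.map_sum_le (t := Finset.Icc 1 T) (w := fun _ => (T : ℝ)⁻¹) (p := w)
      (fun _ _ => by positivity) (by simp [hTpos.ne']) (fun _ _ => Set.mem_univ _)
    rw [← Finset.smul_sum, ← hwbar, ← Finset.smul_sum] at this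
    simpa using this
  have hJ1 := hJ f hfconv
  have hJ2 := mul_le_mul_of_nonneg_left (hJ Ψ hΨconv) hlam
  set S := ∑ s ∈ Finset.Icc 1 T,
      ((f (w s) + lam * Ψ (w s)) - (f wstar + lam * Ψ wstar)) with hSdef
  have hSeq : S = ∑ s ∈ Finset.Icc 1 T, f (w s) + lam * ∑ s ∈ Finset.Icc 1 T, Ψ (w s)
      - T * (f wstar + lam * Ψ wstar) := by
    rw [hSdef, Finset.sum_sub_distrib, Finset.sum_add_distrib, Finset.mul_sum]
    simp
    ring
  have hfin : (f wbar + lam * Ψ wbar) - (f wstar + lam * Ψ wstar) ≤ (T : ℝ)⁻¹ * S := by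
    have : (T : ℝ)⁻¹ * S = (T : ℝ)⁻¹ * ∑ s ∈ Finset.Icc 1 T, f (w s)
      + lam * ((T : ℝ)⁻¹ * ∑ s ∈ Finset.Icc 1 T, Ψ (w s)) - (f wstar + lam * Ψ wstar) := by
      rw [hSeq]; field_simp
    linarith
  refine hfin.trans ?_
  rw [le_div_iff₀ hq]
  have h6 : e * S = R / G * ((T : ℝ)⁻¹ * S * q) := by rw [hedef]; field_simp
  rw [h6] at hS
  have h7 : R / G * ((T : ℝ)⁻¹ * S * q) ≤ R / G * (2 * G * R) := by
    have : R / G * (2 * G * R) = 2 * R ^ 2 := by field_simp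
    nlinarith
  exact le_of_mul_le_mul_left h7 (by positivity)
end

section
/- Last-iterate convergence of AProx with diminishing step sizes (Theorem 2 of the paper, exact-gradient form): assume G > 0 and R := ‖w^0 − w*‖ > 0, take h(w) = (1/2)‖w‖² (so D_h(u, w) = (1/2)‖u − w‖² and ρ = 1), and use the step sizes η_s = (R/(2G))·(1/√s). Then for every integer T ≥ 1, the last iterate satisfies F_λ(w^T) − F_λ(w*) ≤ G R (2 + 1.5 ln T)/√T. -/
open RealInnerProductSpace

theorem prox_aux {E : Type*} [NormedAddCommGroup E] [InnerProductSpace ℝ E]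
    (c : E → ℝ) (hc : ConvexOn ℝ Set.univ c) (a x : E)
    (hx : ∀ y, c x + (1 / 2) * ‖x - a‖ ^ 2 ≤ c y + (1 / 2) * ‖y - a‖ ^ 2) (y : E) :
    c x + (1 / 2) * ‖x - a‖ ^ 2 + (1 / 2) * ‖y - x‖ ^ 2 ≤ c y + (1 / 2) * ‖y - a‖ ^ 2 := by
  have key : ∀ θ : ℝ, 0 < θ → θ < 1 →
      (1 / 2) * ((1 - θ) * ‖y - x‖ ^ 2) ≤
        c y + (1 / 2) * ‖y - a‖ ^ 2 - (c x + (1 / 2) * ‖x - a‖ ^ 2) := by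
    intro θ h0 h1
    have h2 := hc.2 (Set.mem_univ x) (Set.mem_univ y) (sub_nonneg.2 h1.le) h0.le (by ring)
    have h3 := hx ((1 - θ) • x + θ • y)
    have h4 : ‖(1 - θ) • x + θ • y - a‖ ^ 2
        = (1 - θ) * ‖x - a‖ ^ 2 + θ * ‖y - a‖ ^ 2 - θ * (1 - θ) * ‖y - x‖ ^ 2 := by
      have e1 : (1 - θ) • x + θ • y - a = (1 - θ) • (x - a) + θ • (y - a) := by module
      have e2 : y - x = (y - a) - (x - a) := by abel
      rw [e1, e2, norm_add_sq_real, norm_sub_sq_real (y - a) (x - a), norm_smul, norm_smul,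
        real_inner_smul_left, real_inner_smul_right, mul_pow, mul_pow, Real.norm_eq_abs,
        Real.norm_eq_abs, sq_abs, sq_abs, real_inner_comm (y - a) (x - a)]
      ring
    rw [h4] at h3
    simp only [smul_eq_mul] at h2
    refine le_of_mul_le_mul_left ?_ h0
    nlinarith
  have hN : 0 ≤ ‖y - x‖ ^ 2 := by positivity
  refine le_of_forall_pos_le_add fun ε hε => ?_
  have hd : (0 : ℝ) < ‖y - x‖ ^ 2 + ε + 1 := by positivity
  have k := key (ε / (‖y - x‖ ^ 2 + ε + 1)) (by positivity)
    (by rw [div_lt_one hd]; linarith)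
  have : ε / (‖y - x‖ ^ 2 + ε + 1) * ‖y - x‖ ^ 2 ≤ ε := by
    rw [div_mul_eq_mul_div, div_le_iff₀ hd]
    nlinarith
  nlinarith

theorem last_aux (q η : ℕ → ℝ) (C B : ℝ) (T : ℕ) (hT : 1 ≤ T)
    (hq : ∀ s, 1 ≤ s → 0 ≤ q s)
    (hmono : ∀ s t, 1 ≤ s → s ≤ t → η t ≤ η s)
    (hall : ∑ s ∈ Finset.Ico 1 (T + 1), η s * q s
      ≤ B + ∑ s ∈ Finset.Ico 1 (T + 1), C / (s : ℝ))
    (hreg : ∀ m, 1 ≤ m → m ≤ T → ∑ s ∈ Finset.Ico m (T + 1), η s * (q s - q m)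
      ≤ ∑ s ∈ Finset.Ico m (T + 1), C / (s : ℝ)) :
    η T * q T ≤ B / T + C / T + ∑ t ∈ Finset.Ico 1 T, C / ((t : ℝ) * ((T : ℝ) - t)) := by
  have main : ∀ m, m ≤ T → 1 ≤ m →
      η T * q T ≤ (∑ s ∈ Finset.Ico m (T + 1), η s * q s) / ((T : ℝ) + 1 - m) + C / T
        - (∑ s ∈ Finset.Ico m (T + 1), C / (s : ℝ)) / ((T : ℝ) + 1 - m)
        + ∑ t ∈ Finset.Ico m T, C / ((t : ℝ) * ((T : ℝ) - t)) := by
    intro m hm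
    induction hm using Nat.decreasingInduction with
    | self => intro _; simp
    | of_succ m hm ih =>
      intro h1
      have ih := ih (by omega)
      have hr := hreg m h1 hm.le
      have hk : (0 : ℝ) < (T : ℝ) - m := by
        have : (m : ℝ) < T := by exact_mod_cast hm
        linarith
      have hmp : (0 : ℝ) < m := by exact_mod_cast h1
      rw [Finset.sum_eq_sum_Ico_succ_bot (by omega : m < T + 1),
        Finset.sum_eq_sum_Ico_succ_bot (by omega : m < T + 1)] at hr ⊢
      rw [Finset.sum_eq_sum_Ico_succ_bot hm]
      have hs : ∑ s ∈ Finset.Ico (m + 1) (T + 1), η s * q s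
          - ((T : ℝ) - m) * (η m * q m)
          ≤ ∑ s ∈ Finset.Ico (m + 1) (T + 1), η s * (q s - q m) := by
        have hc : ((T : ℝ) - m) * (η m * q m)
            = ∑ s ∈ Finset.Ico (m + 1) (T + 1), η m * q m := by
          rw [Finset.sum_const, Nat.card_Ico, nsmul_eq_mul]
          have : T + 1 - (m + 1) = T - m := by omega
          rw [this, Nat.cast_sub hm.le]
        rw [hc, ← Finset.sum_sub_distrib]
        refine Finset.sum_le_sum fun s hs => ?_
        rw [Finset.mem_Ico] at hs
        have := mul_le_mul_of_nonneg_right (hmono m s h1 (by omega)) (hq m h1)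
        linarith
      push_cast at ih
      generalize (∑ s ∈ Finset.Ico (m + 1) (T + 1), η s * q s) = S at *
      generalize (∑ s ∈ Finset.Ico (m + 1) (T + 1), C / (s : ℝ)) = V at *
      generalize (∑ t ∈ Finset.Ico (m + 1) T, C / ((t : ℝ) * ((T : ℝ) - t))) = Z at *
      generalize (∑ s ∈ Finset.Ico (m + 1) (T + 1), η s * (q s - q m)) = Y at *
      have e1 : (T : ℝ) + 1 - (m + 1) = T - m := by ring
      have e2 : (T : ℝ) + 1 - m = (T - m) + 1 := by ring
      rw [e1] at ih
      rw [e2]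
      generalize (T : ℝ) - m = k at *
      generalize η m * q m = a at *
      have hr' : S ≤ k * a + C / m + V := by
        rw [sub_self, mul_zero] at hr; linarith
      have fin : S / k - V / k ≤ (a + S) / (k + 1) - (C / m + V) / (k + 1) + C / (m * k) := by
        have e : (a + S) / (k + 1) - (C / m + V) / (k + 1) + C / (m * k) - (S / k - V / k)
            = (k * a + C / m + V - S) / (k * (k + 1)) := by
          field_simp
          ring
        have : 0 ≤ (k * a + C / m + V - S) / (k * (k + 1)) := by
          apply div_nonneg (by linarith) (by positivity)
        linarith
      linarith
  have h := main 1 hT le_rfl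
  have hTp : (0 : ℝ) < T := by exact_mod_cast hT
  have e : (T : ℝ) + 1 - (1 : ℕ) = T := by push_cast; ring
  rw [e] at h
  have h2 := div_le_div_of_nonneg_right hall hTp.le
  rw [add_div] at h2
  linarith

theorem harm_aux_s17 (T : ℕ) (hT : 1 ≤ T) :
    ∑ t ∈ Finset.Ico 1 T, 1 / ((t : ℝ) * ((T : ℝ) - t)) ≤ 2 * (1 + Real.log T) / T := by
  have hTp : (0 : ℝ) < T := by exact_mod_cast hT
  have h1 : ∑ t ∈ Finset.Ico 1 T, 1 / ((t : ℝ) * ((T : ℝ) - t))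
      = ∑ t ∈ Finset.Ico 1 T, (1 / (t : ℝ)) / T + ∑ t ∈ Finset.Ico 1 T, (1 / ((T : ℝ) - t)) / T := by
    rw [← Finset.sum_add_distrib]
    refine Finset.sum_congr rfl fun t ht => ?_
    rw [Finset.mem_Ico] at ht
    have a : (0 : ℝ) < t := by exact_mod_cast ht.1
    have b : (0 : ℝ) < (T : ℝ) - t := by
      have : (t : ℝ) < T := by exact_mod_cast ht.2
      linarith
    field_simp
    ring
  have h2 : ∑ t ∈ Finset.Ico 1 T, (1 / ((T : ℝ) - t)) / T = ∑ t ∈ Finset.Ico 1 T, (1 / (t : ℝ)) / T := by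
    refine Finset.sum_bij' (fun t _ => T - t) (fun t _ => T - t) ?_ ?_ ?_ ?_ ?_
    · intro t ht; rw [Finset.mem_Ico] at *; omega
    · intro t ht; rw [Finset.mem_Ico] at *; omega
    · intro t ht; rw [Finset.mem_Ico] at *; omega
    · intro t ht; rw [Finset.mem_Ico] at *; omega
    · intro t ht; rw [Finset.mem_Ico] at ht; rw [Nat.cast_sub ht.2.le]
  have h3 : ∑ t ∈ Finset.Ico 1 T, (1 / (t : ℝ)) ≤ 1 + Real.log T := by
    have := harmonic_le_one_add_log T
    rw [harmonic_eq_sum_Icc] at this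
    push_cast at this
    refine le_trans ?_ this
    simp only [one_div]
    refine Finset.sum_le_sum_of_subset_of_nonneg ?_ fun i _ _ => by positivity
    intro t ht
    rw [Finset.mem_Ico] at ht; rw [Finset.mem_Icc]; omega
  rw [h1, h2, ← Finset.sum_div]
  have := div_le_div_of_nonneg_right h3 hTp.le
  rw [mul_div_assoc]
  linarith

/-- Last-iterate convergence of AProx with diminishing step sizes
(Theorem 2 of the paper, exact-gradient form): with `G > 0`, `R := ‖w^0 − w*‖ > 0`,
`h(w) = (1/2)‖w‖²` (so `D_h(u,w) = (1/2)‖u − w‖²`, `ρ = 1`) and step sizes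
`η_s = (R/(2G))·(1/√s)`, for every `T ≥ 1` the last iterate satisfies
`F_λ(w^T) − F_λ(w*) ≤ G R (2 + 1.5 ln T)/√T`. -/
theorem aprox_last_iterate_diminishing
    {E : Type*} [NormedAddCommGroup E] [InnerProductSpace ℝ E] [FiniteDimensional ℝ E]
    (Ψ : E → ℝ) (GΨ : ℝ) (hGΨ : 0 ≤ GΨ)
    (hΨconv : ConvexOn ℝ Set.univ Ψ)
    (hΨlip : ∀ x y : E, |Ψ x - Ψ y| ≤ GΨ * ‖x - y‖)
    (lam : ℝ) (hlam : 0 ≤ lam)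
    (Gf : ℝ) (hGf : 0 ≤ Gf)
    (f : E → ℝ)
    (hfconv : ConvexOn ℝ Set.univ f)
    (hflip : ∀ x y : E, |f x - f y| ≤ Gf * ‖x - y‖)
    (G : ℝ) (hG : G = Gf + lam * GΨ) (hGpos : 0 < G)
    (wstar : E)
    (hstar : ∀ y : E, f wstar + lam * Ψ wstar ≤ f y + lam * Ψ y)
    (w g : ℕ → E)
    (R : ℝ) (hR : R = ‖w 0 - wstar‖) (hRpos : 0 < R)
    (η : ℕ → ℝ)
    (hη : ∀ s : ℕ, 1 ≤ s → η s = (R / (2 * G)) * (1 / Real.sqrt s))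
    (hw1 : w 1 = w 0)
    (hsub : ∀ s, 1 ≤ s → ∀ y : E, f (w s) + ⟪g s, y - w s⟫ ≤ f y)
    (hgnorm : ∀ s, 1 ≤ s → ‖g s‖ ≤ Gf)
    (hiter : ∀ t, 1 ≤ t → ∀ y : E,
      (∑ s ∈ Finset.Icc 1 t, η s * (⟪g s, w (t + 1)⟫ + lam * Ψ (w (t + 1))))
          + (1 / 2) * ‖w (t + 1) - w 0‖ ^ 2
        ≤ (∑ s ∈ Finset.Icc 1 t, η s * (⟪g s, y⟫ + lam * Ψ y))
          + (1 / 2) * ‖y - w 0‖ ^ 2) :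
    ∀ T : ℕ, 1 ≤ T →
      (f (w T) + lam * Ψ (w T)) - (f wstar + lam * Ψ wstar)
        ≤ G * R * (2 + 1.5 * Real.log T) / Real.sqrt T := by
  have hΦ : ∀ t, ∀ y : E,
      (∑ s ∈ Finset.Icc 1 t, η s * (⟪g s, w (t + 1)⟫ + lam * Ψ (w (t + 1))))
          + (1 / 2) * ‖w (t + 1) - w 0‖ ^ 2 + (1 / 2) * ‖y - w (t + 1)‖ ^ 2
        ≤ (∑ s ∈ Finset.Icc 1 t, η s * (⟪g s, y⟫ + lam * Ψ y))
          + (1 / 2) * ‖y - w 0‖ ^ 2 := by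
    intro t y
    rcases Nat.eq_zero_or_pos t with rfl | ht
    · simp [hw1]
    refine prox_aux (fun y => ∑ s ∈ Finset.Icc 1 t, η s * (⟪g s, y⟫ + lam * Ψ y)) ?_ (w 0)
      (w (t + 1)) (hiter t ht) y
    refine ⟨convex_univ, ?_⟩
    intro x _ y _ a b ha hb hab
    simp only [smul_eq_mul, Finset.mul_sum]
    rw [← Finset.sum_add_distrib]
    refine Finset.sum_le_sum fun s hs => ?_
    have hs1 : 1 ≤ s := (Finset.mem_Icc.1 hs).1
    have hηs : 0 ≤ η s := by rw [hη s hs1]; positivity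
    have hc := hΨconv.2 (Set.mem_univ x) (Set.mem_univ y) ha hb hab
    simp only [smul_eq_mul] at hc
    have hc2 := mul_le_mul_of_nonneg_left (mul_le_mul_of_nonneg_left hc hlam) hηs
    rw [inner_add_right, real_inner_smul_right, real_inner_smul_right]
    linarith
  have hreg : ∀ (u : E) (p n : ℕ), p ≤ n →
      ∑ s ∈ Finset.Ico (p + 1) (n + 1), η s * ((f (w s) + lam * Ψ (w s)) - (f u + lam * Ψ u))
      ≤ ((∑ s ∈ Finset.Icc 1 n, η s * (⟪g s, w (n + 1)⟫ + lam * Ψ (w (n + 1))))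
          + (1 / 2) * ‖w (n + 1) - w 0‖ ^ 2)
        - ((∑ s ∈ Finset.Icc 1 n, η s * (⟪g s, u⟫ + lam * Ψ u)) + (1 / 2) * ‖u - w 0‖ ^ 2)
        - ((∑ s ∈ Finset.Icc 1 p, η s * (⟪g s, w (p + 1)⟫ + lam * Ψ (w (p + 1))))
          + (1 / 2) * ‖w (p + 1) - w 0‖ ^ 2)
        + ((∑ s ∈ Finset.Icc 1 p, η s * (⟪g s, u⟫ + lam * Ψ u)) + (1 / 2) * ‖u - w 0‖ ^ 2)
        + ∑ s ∈ Finset.Ico (p + 1) (n + 1), (R ^ 2 / 8) / (s : ℝ) := by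
    intro u p n hpn
    induction n, hpn using Nat.le_induction with
    | base => simp
    | succ n hpn ih =>
      rw [Finset.sum_Ico_succ_top (by omega : p + 1 ≤ n + 1),
        Finset.sum_Ico_succ_top (by omega : p + 1 ≤ n + 1)]
      rw [Finset.sum_Icc_succ_top (by omega : 1 ≤ n + 1),
        Finset.sum_Icc_succ_top (by omega : 1 ≤ n + 1)]
      have h1 := hΦ n (w (n + 1 + 1))
      have hs1 : 1 ≤ n + 1 := by omega
      have hηs : 0 ≤ η (n + 1) := by rw [hη _ hs1]; positivity
      have hη2 : (η (n + 1) * G) ^ 2 / 2 = (R ^ 2 / 8) / ((n + 1 : ℕ) : ℝ) := by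
        have : (0 : ℝ) < ((n + 1 : ℕ) : ℝ) := by positivity
        have hsq := Real.sq_sqrt this.le
        have hsp := Real.sqrt_pos.2 this
        rw [hη _ hs1]
        nth_rewrite 2 [← hsq]
        field_simp
        ring
      have hlin := hsub (n + 1) hs1 u
      rw [inner_sub_right] at hlin
      have hφ : (⟪g (n + 1), w (n + 1)⟫ + lam * Ψ (w (n + 1)))
          - (⟪g (n + 1), w (n + 1 + 1)⟫ + lam * Ψ (w (n + 1 + 1)))
          ≤ G * ‖w (n + 1 + 1) - w (n + 1)‖ := by
        have i1 := real_inner_le_norm (g (n + 1)) (w (n + 1) - w (n + 1 + 1))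
        rw [inner_sub_right, norm_sub_rev] at i1
        have i2 := mul_le_mul_of_nonneg_right (hgnorm (n + 1) hs1)
          (norm_nonneg (w (n + 1 + 1) - w (n + 1)))
        have i3 := (abs_le.1 (hΨlip (w (n + 1)) (w (n + 1 + 1)))).2
        rw [norm_sub_rev] at i3
        have i4 := mul_le_mul_of_nonneg_left i3 hlam
        rw [hG]
        linarith
      have hφ2 := mul_le_mul_of_nonneg_left hφ hηs
      have hF : (f (w (n + 1)) + lam * Ψ (w (n + 1))) - (f u + lam * Ψ u)
          ≤ (⟪g (n + 1), w (n + 1)⟫ + lam * Ψ (w (n + 1)))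
            - (⟪g (n + 1), u⟫ + lam * Ψ u) := by linarith
      have hF2 := mul_le_mul_of_nonneg_left hF hηs
      have hsq := sq_nonneg (η (n + 1) * G - ‖w (n + 1 + 1) - w (n + 1)‖)
      rw [← hη2]
      linarith
  intro T hT
  have hTp : (0 : ℝ) < T := by exact_mod_cast hT
  have hlast := last_aux (fun s => (f (w s) + lam * Ψ (w s)) - (f wstar + lam * Ψ wstar)) η
    (R ^ 2 / 8) (R ^ 2 / 2) T hT (fun s _ => sub_nonneg.2 (hstar _)) ?_ ?_ ?_
  · have hh := mul_le_mul_of_nonneg_left (harm_aux_s17 T hT) (by positivity : 0 ≤ R ^ 2 / 8)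
    rw [Finset.mul_sum] at hh
    simp only [mul_one_div] at hh
    have hsp := Real.sqrt_pos.2 hTp
    have hsq := Real.sq_sqrt hTp.le
    have hL : 0 ≤ Real.log T := Real.log_nonneg (by exact_mod_cast hT)
    have h3 := hlast.trans (add_le_add_right hh _)
    beta_reduce at h3
    rw [hη T hT] at h3
    generalize (f (w T) + lam * Ψ (w T)) - (f wstar + lam * Ψ wstar) = q at *
    rw [← hsq] at h3
    have hlog : Real.log (√(T : ℝ) ^ 2) = Real.log T := by rw [hsq]
    rw [hlog, Real.sqrt_sq hsp.le] at h3
    generalize √(T : ℝ) = r at *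
    generalize Real.log T = L at *
    have e1 : q = (2 * G * r / R) * (R / (2 * G) * (1 / r) * q) := by field_simp
    rw [e1]
    refine (mul_le_mul_of_nonneg_left h3 (by positivity)).trans ?_
    have e2 : 2 * G * r / R * (R ^ 2 / 2 / r ^ 2 + R ^ 2 / 8 / r ^ 2
        + R ^ 2 / 8 * (2 * (1 + L) / r ^ 2)) = G * R * (1.75 + 0.5 * L) / r := by
      field_simp
      ring
    rw [e2]
    gcongr <;> norm_num
  · intro s t hs hst
    rw [hη s hs, hη t (hs.trans hst)]
    have : (0 : ℝ) < s := by exact_mod_cast hs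
    have := Real.sqrt_pos.2 this
    gcongr
  · have h := hreg wstar 0 T (by omega)
    have h2 := hΦ T wstar
    have h3 : 0 ≤ ‖wstar - w (T + 1)‖ ^ 2 := by positivity
    have h4 : ‖wstar - w 0‖ = R := by rw [hR, norm_sub_rev]
    simp only [zero_add, hw1, sub_self, norm_zero, Finset.Icc_eq_empty_of_lt zero_lt_one,
      Finset.sum_empty] at h
    rw [h4] at h h2
    linarith
  · intro m hm hmT
    obtain ⟨p, rfl⟩ : ∃ p, m = p + 1 := ⟨m - 1, by omega⟩
    have h := hreg (w (p + 1)) p T (by omega)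
    have h2 := hΦ T (w (p + 1))
    have h3 : 0 ≤ ‖w (p + 1) - w (T + 1)‖ ^ 2 := by positivity
    simp only [sub_sub_sub_cancel_right]
    linarith
end
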